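/- Structure of classical–classical–quantum states with vanishing conditional mutual information: Let X and Y be random variables with values in finite sets 𝒳 and 𝒴, let M be a quantum system with Hilbert space ℂ^d, and consider a classical–classical–quantum state given by a joint probability mass function p(x,y) and states ρ(x,y) of M (defined for p(x,y) > 0), such that I(X:Y|M) = 0. Then there exist N ≥ 1, a probability distribution r on {1,…,N}, probability distributions p(·|i) on 𝒳 and p(·|i) on 𝒴 for each i, positive integers a₁,…,a_N and b₁,…,b_N with Σᵢ aᵢ bᵢ = d, a unitary d×d matrix U, and states ρᵢˣ(x) on ℂ^{aᵢ} and ρᵢʸ(y) on ℂ^{bᵢ}, such that for all x, y: Σᵢ r(i) p(x|i) p(y|i) = p(x,y), and whenever p(x,y) > 0, U ρ(x,y) U† equals the block-diagonal matrix with i-th block r(i) p(x|i) p(y|i) ρᵢˣ(x) ⊗ ρᵢʸ(y) / p(x,y). -/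

import Mathlib

open Matrix
open scoped ComplexOrder Kronecker Classical

noncomputable section

/-- A state of a finite-dimensional quantum system: a positive semidefinite matrix with
unit trace. -/
def IsState {ι : Type*} [Fintype ι] [DecidableEq ι] (ρ : Matrix ι ι ℂ) : Prop :=
  ρ.PosSemidef ∧ ρ.trace = 1

/-- The von Neumann entropy `S(ρ) = -Σᵢ λᵢ ln λᵢ`, the sum running over the eigenvalues of
`ρ` (with `0 ln 0 = 0`; junk value `0` on non-Hermitian matrices). -/
def vnEnt {ι : Type*} [Fintype ι] [DecidableEq ι] (ρ : Matrix ι ι ℂ) : ℝ :=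
  if h : ρ.IsHermitian then -∑ i, h.eigenvalues i * Real.log (h.eigenvalues i) else 0

/-- The Shannon entropy `S = -Σ p ln p` of a probability mass function on a finite set. -/
def shannonEnt {𝒳 : Type*} [Fintype 𝒳] (p : 𝒳 → ℝ) : ℝ := -∑ x, p x * Real.log (p x)

/-- The conditional entropy `S(A|M) = S(M|A) + S(A) - S(M)` of the classical system `A` of a
classical-quantum state `(p, ρ)` given the quantum system `M`. -/
def condEntF {𝒳 ι : Type*} [Fintype 𝒳] [Fintype ι] [DecidableEq ι]
    (p : 𝒳 → ℝ) (ρ : 𝒳 → Matrix ι ι ℂ) : ℝ :=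
  (∑ x, p x * vnEnt (ρ x)) + shannonEnt p - vnEnt (∑ x, ((p x : ℝ) : ℂ) • ρ x)

/-- The conditional mutual information `I(X:Y|M) = S(X|M) + S(Y|M) - S(X,Y|M)` of the two
classical systems of a classical-classical-quantum state given the quantum system `M`. -/
def cmiF {𝒳 𝒴 ι : Type*} [Fintype 𝒳] [Fintype 𝒴] [Fintype ι] [DecidableEq ι]
    (p : 𝒳 → 𝒴 → ℝ) (ρ : 𝒳 → 𝒴 → Matrix ι ι ℂ) : ℝ :=
  condEntF (fun x => ∑ y, p x y)
      (fun x => (((∑ y, p x y : ℝ)) : ℂ)⁻¹ • ∑ y, ((p x y : ℝ) : ℂ) • ρ x y)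
    + condEntF (fun y => ∑ x, p x y)
      (fun y => (((∑ x, p x y : ℝ)) : ℂ)⁻¹ • ∑ x, ((p x y : ℝ) : ℂ) • ρ x y)
    - condEntF (fun xy : 𝒳 × 𝒴 => p xy.1 xy.2) (fun xy => ρ xy.1 xy.2)

lemma resolvent_indep (s : Finset ℝ) (hs : ∀ c ∈ s, 0 ≤ c) (z : ℝ → ℂ)
    (h : ∀ t : ℝ, 0 < t → ∑ c ∈ s, z c / ((c : ℂ) + t) = 0) : ∀ c ∈ s, z c = 0 := by
  set P : Polynomial ℂ := ∑ c ∈ s, Polynomial.C (z c) *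
    ∏ c' ∈ s.erase c, (Polynomial.X + Polynomial.C (c' : ℂ)) with hP
  have hP0 : P = 0 := by
    apply Polynomial.eq_zero_of_infinite_isRoot
    have hinf : (Set.Ioi (0:ℝ)).Infinite := Set.Ioi_infinite 0
    refine (hinf.image (f := fun t : ℝ => (t : ℂ)) ?_).mono ?_
    · intro a _ b _ hab; exact Complex.ofReal_injective hab
    · rintro _ ⟨t, ht, rfl⟩
      have ht' : (0:ℝ) < t := ht
      have hne : ∀ c ∈ s, (c : ℂ) + t ≠ 0 := by
        intro c hc
        have : (0:ℝ) < c + t := by have := hs c hc; linarith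
        exact_mod_cast this.ne'
      show P.eval (t : ℂ) = 0
      rw [hP, Polynomial.eval_finsetSum]
      have : (∏ c ∈ s, ((c : ℂ) + t)) * ∑ c ∈ s, z c / ((c : ℂ) + t) = 0 := by
        rw [h t ht', mul_zero]
      rw [← this, Finset.mul_sum]
      refine Finset.sum_congr rfl fun c hc => ?_
      rw [← Finset.mul_prod_erase s _ hc, Polynomial.eval_mul, Polynomial.eval_prod]
      have := hne c hc
      simp only [Polynomial.eval_C, Polynomial.eval_add, Polynomial.eval_X]
      rw [Finset.prod_congr rfl (fun (x : ℝ) _ => add_comm (t : ℂ) (x : ℂ))]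
      field_simp
  intro c hc
  have h1 : P.eval (-(c : ℂ)) = 0 := by rw [hP0]; simp
  rw [hP, Polynomial.eval_finsetSum, Finset.sum_eq_single c] at h1
  · rw [Polynomial.eval_mul, Polynomial.eval_prod] at h1
    rcases mul_eq_zero.mp h1 with h2 | h2
    · simpa using h2
    · exfalso
      rw [Finset.prod_eq_zero_iff] at h2
      obtain ⟨c', hc', h3⟩ := h2
      have : c' = c := by
        simp at h3
        have : (c' : ℂ) = c := by linear_combination h3
        exact_mod_cast this
      exact (Finset.mem_erase.mp hc').1 this
  · intro c' hc' hne
    rw [Polynomial.eval_mul, Polynomial.eval_prod, Finset.prod_eq_zero (i := c)]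
    · simp
    · exact Finset.mem_erase.mpr ⟨hne.symm, hc⟩
    · simp
  · intro h; exact absurd hc h

section Analysis
variable {n : Type*} [Fintype n] [DecidableEq n]

lemma trace_conj_diag (W : Matrix n n ℂ) (a : n → ℝ) :
    (Wᴴ * diagonal (fun i => (a i : ℂ)) * W).trace.re = ∑ i, ∑ j, a i * Complex.normSq (W i j) := by
  rw [Finset.sum_comm]
  have : ∀ j, (Wᴴ * diagonal (fun i => (a i : ℂ)) * W) j j
      = ∑ i, ((a i * Complex.normSq (W i j) : ℝ) : ℂ) := by
    intro j
    rw [Matrix.mul_apply]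
    refine Finset.sum_congr rfl fun i _ => ?_
    rw [Matrix.mul_diagonal, Matrix.conjTranspose_apply]
    push_cast
    rw [Complex.normSq_eq_conj_mul_self]
    simp only [Complex.star_def]
    ring
  simp only [Matrix.trace, Matrix.diag, this, Complex.re_sum, Complex.ofReal_re]

/-- the quadratic functional whose infimum is the resolvent function -/
def QF (t : ℝ) (A B X : Matrix n n ℂ) : ℝ :=
  ((1 - X)ᴴ * A * (1 - X)).trace.re + t * (X * B * Xᴴ).trace.re

lemma QF_sum {κ : Type*} [Fintype κ] (t : ℝ) (A B : κ → Matrix n n ℂ) (X : Matrix n n ℂ) :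
    QF t (∑ k, A k) (∑ k, B k) X = ∑ k, QF t (A k) (B k) X := by
  simp only [QF, Finset.mul_sum, Finset.sum_mul, Matrix.trace_sum, Complex.re_sum,
    Finset.sum_add_distrib]

lemma QF_eq (t : ℝ) (U V X : Matrix n n ℂ) (a b : n → ℝ) (hU : U * Uᴴ = 1) (hV : V * Vᴴ = 1) :
    QF t (U * diagonal (fun i => (a i : ℂ)) * Uᴴ) (V * diagonal (fun i => (b i : ℂ)) * Vᴴ) X
     = ∑ i, ∑ j, (a i * Complex.normSq ((Uᴴ * V) i j - (Uᴴ * X * V) i j)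
        + t * (b j * Complex.normSq ((Uᴴ * X * V) i j))) := by
  have h1 : ((1 - X)ᴴ * (U * diagonal (fun i => (a i : ℂ)) * Uᴴ) * (1 - X)).trace
      = ((Uᴴ * V - Uᴴ * X * V)ᴴ * diagonal (fun i => (a i : ℂ)) * (Uᴴ * V - Uᴴ * X * V)).trace := by
    have e1 : Uᴴ * V - Uᴴ * X * V = Uᴴ * (1 - X) * V := by
      simp [mul_sub, sub_mul]
    rw [e1]
    simp only [conjTranspose_mul, conjTranspose_conjTranspose]
    rw [Matrix.mul_assoc Vᴴ, Matrix.mul_assoc Vᴴ, Matrix.trace_mul_comm Vᴴ]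
    simp only [Matrix.mul_assoc]
    rw [hV, Matrix.mul_one]
  have h2 : (X * (V * diagonal (fun i => (b i : ℂ)) * Vᴴ) * Xᴴ).trace
      = (((Uᴴ * X * V)ᴴ)ᴴ * diagonal (fun i => (b i : ℂ)) * (Uᴴ * X * V)ᴴ).trace := by
    simp only [conjTranspose_mul, conjTranspose_conjTranspose]
    rw [Matrix.mul_assoc Uᴴ, Matrix.mul_assoc Uᴴ, Matrix.mul_assoc Uᴴ,
      Matrix.trace_mul_comm Uᴴ]
    simp only [Matrix.mul_assoc]
    rw [hU, Matrix.mul_one]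
  rw [QF, h1, h2, trace_conj_diag, trace_conj_diag,
    Finset.sum_comm (f := fun i j => b i * _), Finset.mul_sum, ← Finset.sum_add_distrib]
  refine Finset.sum_congr rfl fun i _ => ?_
  rw [Finset.mul_sum, ← Finset.sum_add_distrib]
  refine Finset.sum_congr rfl fun j _ => ?_
  simp [Complex.normSq_apply]
end Analysis

section Analysis2
variable {n : Type*} [Fintype n] [DecidableEq n]

/-- eigenvector unitary (junk `1`) -/
def evU (A : Matrix n n ℂ) : Matrix n n ℂ :=
  if h : A.IsHermitian then (h.eigenvectorUnitary : Matrix n n ℂ) else 1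

/-- eigenvalues (junk `0`) -/
def ev (A : Matrix n n ℂ) : n → ℝ :=
  if h : A.IsHermitian then h.eigenvalues else 0

lemma evU_mul (A : Matrix n n ℂ) : evU A * (evU A)ᴴ = 1 := by
  unfold evU
  split_ifs with h
  · exact Unitary.mul_star_self_of_mem h.eigenvectorUnitary.2
  · simp

lemma evU_mul' (A : Matrix n n ℂ) : (evU A)ᴴ * evU A = 1 := by
  unfold evU
  split_ifs with h
  · exact Unitary.star_mul_self_of_mem h.eigenvectorUnitary.2
  · simp

lemma ev_spec {A : Matrix n n ℂ} (h : A.IsHermitian) :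
    A = evU A * diagonal (fun i => (ev A i : ℂ)) * (evU A)ᴴ := by
  have := h.spectral_theorem
  rw [Unitary.conjStarAlgAut_apply] at this
  simp only [evU, ev, dif_pos h]
  exact this

lemma evU_left {A : Matrix n n ℂ} (h : A.IsHermitian) :
    (evU A)ᴴ * A = diagonal (fun i => (ev A i : ℂ)) * (evU A)ᴴ := by
  have := congrArg (fun M => (evU A)ᴴ * M) (ev_spec h)
  rw [← Matrix.mul_assoc, ← Matrix.mul_assoc, evU_mul', Matrix.one_mul] at this
  exact this

lemma evU_right {A : Matrix n n ℂ} (h : A.IsHermitian) :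
    A * evU A = evU A * diagonal (fun i => (ev A i : ℂ)) := by
  have := congrArg (fun M => M * evU A) (ev_spec h)
  rw [Matrix.mul_assoc _ _ (evU A), evU_mul', Matrix.mul_one] at this
  exact this

lemma ev_nonneg {A : Matrix n n ℂ} (h : A.PosSemidef) (i : n) : 0 ≤ ev A i := by
  simp only [ev, dif_pos h.1]
  exact h.eigenvalues_nonneg i

lemma vnEnt_eq (A : Matrix n n ℂ) : vnEnt A = -∑ i, ev A i * Real.log (ev A i) := by
  unfold vnEnt ev
  split_ifs with h <;> simp

lemma point_eq (t a b : ℝ) (ht : 0 < t) (ha : 0 ≤ a) (hb : 0 ≤ b) (o y : ℂ) :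
    a * Complex.normSq (o - y) + t * (b * Complex.normSq y)
      = t * a * b / (a + t * b) * Complex.normSq o
        + (a + t * b) * Complex.normSq (y - ((a / (a + t * b) : ℝ) : ℂ) * o) := by
  by_cases h : a + t * b = 0
  · have h1 : 0 ≤ t * b := by positivity
    have ha0 : a = 0 := by linarith
    have hb0 : t * b = 0 := by linarith
    have hb1 : b = 0 := by simpa [ht.ne'] using hb0
    simp [ha0, hb1]
  · simp only [Complex.normSq_apply, Complex.sub_re, Complex.sub_im, Complex.mul_re,
      Complex.mul_im, Complex.ofReal_re, Complex.ofReal_im]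
    field_simp
    ring

/-- the value of the infimum of `QF` -/
def FF (t : ℝ) (A B : Matrix n n ℂ) : ℝ :=
  ∑ i, ∑ j, t * ev A i * ev B j / (ev A i + t * ev B j) *
    Complex.normSq (((evU A)ᴴ * evU B) i j)

lemma QF_sub_FF (t : ℝ) (ht : 0 < t) {A B : Matrix n n ℂ} (hA : A.PosSemidef)
    (hB : B.PosSemidef) (X : Matrix n n ℂ) :
    QF t A B X = FF t A B + ∑ i, ∑ j, (ev A i + t * ev B j) *
      Complex.normSq (((evU A)ᴴ * X * evU B) i j
        - ((ev A i / (ev A i + t * ev B j) : ℝ) : ℂ) * ((evU A)ᴴ * evU B) i j) := by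
  conv_lhs => rw [ev_spec hA.1, ev_spec hB.1]
  rw [QF_eq _ _ _ _ _ _ (evU_mul A) (evU_mul B), FF, ← Finset.sum_add_distrib]
  refine Finset.sum_congr rfl fun i _ => ?_
  rw [← Finset.sum_add_distrib]
  refine Finset.sum_congr rfl fun j _ => ?_
  rw [point_eq t _ _ ht (ev_nonneg hA i) (ev_nonneg hB j)]

lemma FF_le_QF (t : ℝ) (ht : 0 < t) {A B : Matrix n n ℂ} (hA : A.PosSemidef)
    (hB : B.PosSemidef) (X : Matrix n n ℂ) : FF t A B ≤ QF t A B X := by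
  rw [QF_sub_FF t ht hA hB X]
  have : 0 ≤ ∑ i, ∑ j, (ev A i + t * ev B j) *
      Complex.normSq (((evU A)ᴴ * X * evU B) i j
        - ((ev A i / (ev A i + t * ev B j) : ℝ) : ℂ) * ((evU A)ᴴ * evU B) i j) := by
    refine Finset.sum_nonneg fun i _ => Finset.sum_nonneg fun j _ => ?_
    have := ev_nonneg hA i
    have := ev_nonneg hB j
    have := Complex.normSq_nonneg (((evU A)ᴴ * X * evU B) i j
        - ((ev A i / (ev A i + t * ev B j) : ℝ) : ℂ) * ((evU A)ᴴ * evU B) i j)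
    positivity
  linarith

lemma eq_of_QF_eq (t : ℝ) (ht : 0 < t) {A B : Matrix n n ℂ} (hA : A.PosSemidef)
    (hB : B.PosSemidef) (X : Matrix n n ℂ) (h : QF t A B X = FF t A B) :
    A * X + (t : ℂ) • (X * B) = A := by
  rw [QF_sub_FF t ht hA hB X] at h
  have h0 : ∑ i, ∑ j, (ev A i + t * ev B j) *
      Complex.normSq (((evU A)ᴴ * X * evU B) i j
        - ((ev A i / (ev A i + t * ev B j) : ℝ) : ℂ) * ((evU A)ᴴ * evU B) i j) = 0 := by
    linarith
  have hnn : ∀ i j, 0 ≤ (ev A i + t * ev B j) *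
      Complex.normSq (((evU A)ᴴ * X * evU B) i j
        - ((ev A i / (ev A i + t * ev B j) : ℝ) : ℂ) * ((evU A)ᴴ * evU B) i j) := by
    intro i j
    have := ev_nonneg hA i
    have := ev_nonneg hB j
    have := Complex.normSq_nonneg (((evU A)ᴴ * X * evU B) i j
        - ((ev A i / (ev A i + t * ev B j) : ℝ) : ℂ) * ((evU A)ᴴ * evU B) i j)
    positivity
  rw [Finset.sum_eq_zero_iff_of_nonneg
    (fun i _ => Finset.sum_nonneg fun j _ => hnn i j)] at h0
  have h1 : ∀ i j, ((ev A i : ℂ) + t * ev B j) * ((evU A)ᴴ * X * evU B) i j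
      = (ev A i : ℂ) * ((evU A)ᴴ * evU B) i j := by
    intro i j
    have h2 := h0 i (Finset.mem_univ i)
    rw [Finset.sum_eq_zero_iff_of_nonneg (fun j _ => hnn i j)] at h2
    have h3 := h2 j (Finset.mem_univ j)
    by_cases hz : ev A i + t * ev B j = 0
    · have h4 : 0 ≤ ev A i := ev_nonneg hA i
      have h5 : 0 ≤ t * ev B j := mul_nonneg ht.le (ev_nonneg hB j)
      have h6 : ev A i = 0 := by linarith
      have h7 : ((ev A i : ℂ) + t * ev B j) = 0 := by exact_mod_cast hz
      rw [h7, h6]; simp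
    · rcases mul_eq_zero.mp h3 with h4 | h4
      · exact absurd h4 hz
      · rw [Complex.normSq_eq_zero, sub_eq_zero] at h4
        rw [h4]
        have h7 : ((ev A i : ℂ) + t * ev B j) ≠ 0 := by exact_mod_cast hz
        push_cast
        field_simp
  have h2 : (evU A)ᴴ * (A * X + (t : ℂ) • (X * B)) * evU B = (evU A)ᴴ * A * evU B := by
    have e1 : (evU A)ᴴ * A = diagonal (fun i => (ev A i : ℂ)) * (evU A)ᴴ := by
      exact evU_left hA.1
    have e2 : B * evU B = evU B * diagonal (fun i => (ev B i : ℂ)) := by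
      exact evU_right hB.1
    have e3 : (evU A)ᴴ * (A * X + (t : ℂ) • (X * B)) * evU B
        = diagonal (fun i => (ev A i : ℂ)) * ((evU A)ᴴ * X * evU B)
          + (t : ℂ) • (((evU A)ᴴ * X * evU B) * diagonal (fun i => (ev B i : ℂ))) := by
      rw [Matrix.mul_add, Matrix.add_mul, ← Matrix.mul_assoc, e1]
      simp only [Matrix.mul_smul, Matrix.smul_mul, Matrix.mul_assoc, e2]
    rw [e3, e1, Matrix.mul_assoc (diagonal _) (evU A)ᴴ]
    ext i j
    have := h1 i j
    simp only [Matrix.add_apply, Matrix.smul_apply, Matrix.diagonal_mul, Matrix.mul_diagonal,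
      smul_eq_mul]
    rw [← this]; ring
  have h3 := congrArg (fun M => evU A * M * (evU B)ᴴ) h2
  simp only [Matrix.mul_assoc] at h3
  simp only [evU_mul, Matrix.mul_one] at h3
  simpa only [← Matrix.mul_assoc, evU_mul, Matrix.one_mul] using h3

/-- eigenvalue ratios -/
def cc (A B : Matrix n n ℂ) (i j : n) : ℝ := ev A i / ev B j

/-- pieces of the identity -/
def SS (A B : Matrix n n ℂ) (c : ℝ) : Matrix n n ℂ :=
  evU A * (Matrix.of fun i j => if cc A B i j = c then ((evU A)ᴴ * evU B) i j else 0) * (evU B)ᴴ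

/-- set of ratios -/
def sC (A B : Matrix n n ℂ) : Finset ℝ :=
  Finset.univ.image (fun ij : n × n => cc A B ij.1 ij.2)

lemma sum_SS_smul (A B : Matrix n n ℂ) (g : ℝ → ℂ) :
    ∑ c ∈ sC A B, g c • SS A B c
      = evU A * (Matrix.of fun i j => g (cc A B i j) * ((evU A)ᴴ * evU B) i j) * (evU B)ᴴ := by
  have hc : ∀ c, g c • SS A B c = evU A * (g c • Matrix.of fun i j =>
      if cc A B i j = c then ((evU A)ᴴ * evU B) i j else 0) * (evU B)ᴴ := by
    intro c
    rw [SS, Matrix.mul_smul, Matrix.smul_mul]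
  rw [Finset.sum_congr rfl fun c _ => hc c, ← Finset.sum_mul, ← Finset.mul_sum]
  congr 2
  ext i j
  rw [Matrix.sum_apply]
  simp only [Matrix.smul_apply, Matrix.of_apply, smul_eq_mul]
  rw [Finset.sum_eq_single (cc A B i j)]
  · simp
  · intro c _ hc; simp [hc.symm]
  · intro h; exact absurd (Finset.mem_image_of_mem _ (Finset.mem_univ (i, j))) h

lemma sum_SS (A B : Matrix n n ℂ) : ∑ c ∈ sC A B, SS A B c = 1 := by
  have := sum_SS_smul A B (fun _ => 1)
  simp only [one_smul, one_mul] at this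
  rw [this]
  have : (Matrix.of fun i j => ((evU A)ᴴ * evU B) i j) = (evU A)ᴴ * evU B := rfl
  rw [this, ← Matrix.mul_assoc, evU_mul, Matrix.one_mul, evU_mul]

lemma supp_cond {A B : Matrix n n ℂ} (hA : A.PosSemidef) (hB : B.PosSemidef)
    (hle : (B - A).PosSemidef) (i j : n) (hb : ev B j = 0) :
    (ev A i : ℂ) * ((evU A)ᴴ * evU B) i j = 0 := by
  set v : n → ℂ := fun k => evU B k j with hv
  have hBv : B *ᵥ v = 0 := by
    have e2 : B * evU B = evU B * diagonal (fun i => (ev B i : ℂ)) := by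
      exact evU_right hB.1
    ext k
    have := congrFun (congrFun e2 k) j
    rw [Matrix.mul_diagonal, hb, Matrix.mul_apply] at this
    simpa [Matrix.mulVec, dotProduct] using this
  have hAv : A *ᵥ v = 0 := by
    have h1 := hle.dotProduct_mulVec_nonneg v
    have h2 := hA.dotProduct_mulVec_nonneg v
    rw [Matrix.sub_mulVec, hBv, zero_sub, dotProduct_neg] at h1
    have h3 : star v ⬝ᵥ A *ᵥ v = 0 := le_antisymm (by simpa using h1) h2
    exact (hA.dotProduct_mulVec_zero_iff v).mp h3
  have e1 : (evU A)ᴴ * A = diagonal (fun i => (ev A i : ℂ)) * (evU A)ᴴ := by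
    exact evU_left hA.1
  have h4 : ((evU A)ᴴ * A * evU B) i j = 0 := by
    rw [Matrix.mul_assoc, Matrix.mul_apply]
    refine Finset.sum_eq_zero fun k _ => ?_
    have : (A * evU B) k j = (A *ᵥ v) k := by simp [Matrix.mul_apply, Matrix.mulVec, dotProduct, hv]
    rw [this, hAv]; simp
  rw [e1, Matrix.mul_assoc, Matrix.diagonal_mul] at h4
  exact h4

end Analysis2

section Analysis3
variable {n : Type*} [Fintype n] [DecidableEq n]

/-- weights -/
def wa (A B : Matrix n n ℂ) (i j : n) : ℝ :=
  ev A i * Complex.normSq (((evU A)ᴴ * evU B) i j)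

/-- matrix logarithm (on the support) -/
def logm (B : Matrix n n ℂ) : Matrix n n ℂ :=
  evU B * diagonal (fun j => ((Real.log (ev B j) : ℝ) : ℂ)) * (evU B)ᴴ

/-- relative entropy -/
def REl (A B : Matrix n n ℂ) : ℝ := -vnEnt A - (A * logm B).trace.re

/-- interpolating function -/
def GG (A B : Matrix n n ℂ) (t : ℝ) : ℝ := ∑ i, ∑ j, wa A B i j * Real.log (cc A B i j + t)

lemma sum_wa (A B : Matrix n n ℂ) (i : n) : ∑ j, wa A B i j = ev A i := by
  have h : ((evU A)ᴴ * evU B) * ((evU A)ᴴ * evU B)ᴴ = 1 := by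
    rw [conjTranspose_mul, conjTranspose_conjTranspose, Matrix.mul_assoc, ← Matrix.mul_assoc (evU B),
      evU_mul, Matrix.one_mul, evU_mul']
  have h1 := congrFun (congrFun h i) i
  rw [Matrix.mul_apply, Matrix.one_apply_eq] at h1
  have h2 : ∑ j, Complex.normSq (((evU A)ᴴ * evU B) i j) = 1 := by
    have : ((∑ j, Complex.normSq (((evU A)ᴴ * evU B) i j) : ℝ) : ℂ) = 1 := by
      rw [← h1]
      push_cast
      refine Finset.sum_congr rfl fun j _ => ?_
      rw [Matrix.conjTranspose_apply, Complex.star_def, Complex.mul_conj]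
    exact_mod_cast this
  simp only [wa]
  rw [← Finset.mul_sum, h2, mul_one]

lemma sum_ev {A : Matrix n n ℂ} (h : A.IsHermitian) : ∑ i, ev A i = A.trace.re := by
  have := congrArg Matrix.trace (ev_spec h)
  rw [Matrix.trace_mul_comm, ← Matrix.mul_assoc, evU_mul', Matrix.one_mul] at this
  rw [this]
  simp [Matrix.trace]

lemma sum_sum_wa {A : Matrix n n ℂ} (h : A.IsHermitian) (B : Matrix n n ℂ) :
    ∑ i, ∑ j, wa A B i j = A.trace.re := by
  simp only [sum_wa, sum_ev h]

lemma trace_mul_logm {A : Matrix n n ℂ} (h : A.IsHermitian) (B : Matrix n n ℂ) :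
    (A * logm B).trace.re = ∑ i, ∑ j, wa A B i j * Real.log (ev B j) := by
  have h1 : (A * logm B).trace
      = (diagonal (fun i => (ev A i : ℂ)) * ((evU A)ᴴ * evU B) *
        (diagonal (fun j => ((Real.log (ev B j) : ℝ) : ℂ)) * ((evU A)ᴴ * evU B)ᴴ)).trace := by
    have : A * logm B = evU A * (diagonal (fun i => (ev A i : ℂ)) * ((evU A)ᴴ * evU B) *
        (diagonal (fun j => ((Real.log (ev B j) : ℝ) : ℂ)) * (evU B)ᴴ)) := by
      have e : A * logm B = (evU A * diagonal (fun i => (ev A i : ℂ)) * (evU A)ᴴ) * logm B := by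
        rw [← ev_spec h]
      rw [e, logm]; simp only [Matrix.mul_assoc]
    rw [this, Matrix.trace_mul_comm]
    simp only [conjTranspose_mul, conjTranspose_conjTranspose, Matrix.mul_assoc]
  rw [h1]
  simp only [Matrix.trace, Matrix.diag, Complex.re_sum]
  refine Finset.sum_congr rfl fun i _ => ?_
  rw [Matrix.mul_apply, Complex.re_sum]
  refine Finset.sum_congr rfl fun j _ => ?_
  rw [Matrix.diagonal_mul, Matrix.diagonal_mul, Matrix.conjTranspose_apply, wa]
  simp only [Complex.star_def]
  have : (ev A i : ℂ) * ((evU A)ᴴ * evU B) i j *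
      ((Real.log (ev B j) : ℝ) * (starRingEnd ℂ) (((evU A)ᴴ * evU B) i j))
      = ((ev A i * Complex.normSq (((evU A)ᴴ * evU B) i j) * Real.log (ev B j) : ℝ) : ℂ) := by
    push_cast
    rw [← Complex.mul_conj]
    ring
  rw [this, Complex.ofReal_re]

lemma wa_nonneg {A : Matrix n n ℂ} (hA : A.PosSemidef) (B : Matrix n n ℂ) (i j : n) :
    0 ≤ wa A B i j := mul_nonneg (ev_nonneg hA i) (Complex.normSq_nonneg _)

lemma wa_supp {A B : Matrix n n ℂ} (hA : A.PosSemidef) (hB : B.PosSemidef)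
    (hle : (B - A).PosSemidef) (i j : n) (hw : wa A B i j ≠ 0) : 0 < ev A i ∧ 0 < ev B j := by
  constructor
  · refine lt_of_le_of_ne (ev_nonneg hA i) fun h => hw ?_
    simp [wa, ← h]
  · refine lt_of_le_of_ne (ev_nonneg hB j) fun h => hw ?_
    have := supp_cond hA hB hle i j h.symm
    rcases mul_eq_zero.mp this with h | h
    · have : ev A i = 0 := by exact_mod_cast h
      simp [wa, this]
    · simp [wa, h]

lemma GG_zero {A B : Matrix n n ℂ} (hA : A.PosSemidef) (hB : B.PosSemidef)
    (hle : (B - A).PosSemidef) : GG A B 0 = REl A B := by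
  rw [REl, trace_mul_logm hA.1, vnEnt_eq, neg_neg, GG]
  have : ∑ i, ev A i * Real.log (ev A i) = ∑ i, ∑ j, wa A B i j * Real.log (ev A i) := by
    refine Finset.sum_congr rfl fun i _ => ?_
    rw [← Finset.sum_mul, sum_wa]
  rw [this, ← Finset.sum_sub_distrib]
  refine Finset.sum_congr rfl fun i _ => ?_
  rw [← Finset.sum_sub_distrib]
  refine Finset.sum_congr rfl fun j _ => ?_
  by_cases hw : wa A B i j = 0
  · simp [hw]
  · obtain ⟨h1, h2⟩ := wa_supp hA hB hle i j hw
    rw [add_zero, cc, Real.log_div h1.ne' h2.ne']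
    ring

lemma cc_nonneg {A B : Matrix n n ℂ} (hA : A.PosSemidef) (hB : B.PosSemidef) (i j : n) :
    0 ≤ cc A B i j := div_nonneg (ev_nonneg hA i) (ev_nonneg hB j)

lemma GG_deriv {A B : Matrix n n ℂ} (hA : A.PosSemidef) (hB : B.PosSemidef)
    (hle : (B - A).PosSemidef) (t : ℝ) (ht : 0 < t) :
    HasDerivAt (GG A B) (FF t A B / t) t := by
  have h1 : HasDerivAt (GG A B) (∑ i, ∑ j, wa A B i j * (1 / (cc A B i j + t))) t := by
    unfold GG
    refine HasDerivAt.fun_sum fun i _ => HasDerivAt.fun_sum fun j _ => ?_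
    have hpos : 0 < cc A B i j + t := by have := cc_nonneg hA hB i j; linarith
    exact (((hasDerivAt_id t).const_add (cc A B i j)).log hpos.ne').const_mul (wa A B i j)
  convert h1 using 1
  rw [FF, Finset.sum_div]
  refine Finset.sum_congr rfl fun i _ => ?_
  rw [Finset.sum_div]
  refine Finset.sum_congr rfl fun j _ => ?_
  by_cases hw : wa A B i j = 0
  · rw [hw]
    simp only [wa] at hw
    have : t * ev A i * ev B j / (ev A i + t * ev B j) *
        Complex.normSq (((evU A)ᴴ * evU B) i j) = 0 := by
      rcases mul_eq_zero.mp hw with h | h <;> rw [h] <;> simp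
    rw [this]; simp
  · obtain ⟨h1, h2⟩ := wa_supp hA hB hle i j hw
    have h3 : ev A i + t * ev B j ≠ 0 := by positivity
    have h4 : ev A i / ev B j + t ≠ 0 := by positivity
    rw [wa, cc]
    have h5 : ev A i / ev B j + t = (ev A i + t * ev B j) / ev B j := by field_simp
    rw [h5]
    field_simp

lemma GG_cont {A B : Matrix n n ℂ} (hA : A.PosSemidef) (hB : B.PosSemidef)
    (hle : (B - A).PosSemidef) : ContinuousOn (GG A B) (Set.Ici 0) := by
  unfold GG
  refine continuousOn_finsetSum _ fun i _ => continuousOn_finsetSum _ fun j _ => ?_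
  by_cases hw : wa A B i j = 0
  · simp only [hw, zero_mul]; exact continuousOn_const
  · obtain ⟨h1, h2⟩ := wa_supp hA hB hle i j hw
    refine continuousOn_const.mul (ContinuousOn.log (continuousOn_const.add continuousOn_id) ?_)
    intro t ht
    have : 0 < cc A B i j := div_pos h1 h2
    have ht' : (0:ℝ) ≤ t := ht
    have : 0 < cc A B i j + t := by linarith
    exact this.ne'

lemma GG_lim {A : Matrix n n ℂ} (hA : A.IsHermitian) (B : Matrix n n ℂ) :
    Filter.Tendsto (fun t => GG A B t - A.trace.re * Real.log t) Filter.atTop (nhds 0) := by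
  have h1 : ∀ t, GG A B t - A.trace.re * Real.log t
      = ∑ i, ∑ j, wa A B i j * (Real.log (cc A B i j + t) - Real.log t) := by
    intro t
    rw [← sum_sum_wa hA B, GG]
    simp only [Finset.sum_mul, mul_sub, Finset.sum_sub_distrib]
  simp only [h1]
  have h2 : (0:ℝ) = ∑ i : n, ∑ j : n, wa A B i j * 0 := by simp
  rw [h2]
  refine tendsto_finsetSum _ fun i _ => tendsto_finsetSum _ fun j _ => ?_
  refine Filter.Tendsto.const_mul _ ?_
  have h3 : Filter.Tendsto (fun t : ℝ => Real.log (1 + cc A B i j / t)) Filter.atTop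
      (nhds (Real.log (1 + 0))) := by
    refine Filter.Tendsto.log ?_ (by simp)
    exact tendsto_const_nhds.add (Filter.Tendsto.const_div_atTop Filter.tendsto_id _)
  rw [add_zero, Real.log_one] at h3
  refine h3.congr' ?_
  filter_upwards [Filter.eventually_gt_atTop (max 0 (-cc A B i j))] with t ht
  have ht0 : 0 < t := lt_of_le_of_lt (le_max_left _ _) ht
  have ht1 : -cc A B i j < t := lt_of_le_of_lt (le_max_right _ _) ht
  have h4 : cc A B i j + t ≠ 0 := by linarith
  rw [← Real.log_div h4 ht0.ne']
  congr 1
  field_simp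
  ring

/-- the optimizer -/
def XX (t : ℝ) (A B : Matrix n n ℂ) : Matrix n n ℂ :=
  ∑ c ∈ sC A B, ((c / (c + t) : ℝ) : ℂ) • SS A B c

lemma QF_XX (t : ℝ) (ht : 0 < t) {A B : Matrix n n ℂ} (hA : A.PosSemidef)
    (hB : B.PosSemidef) (hle : (B - A).PosSemidef) : QF t A B (XX t A B) = FF t A B := by
  rw [QF_sub_FF t ht hA hB]
  have h1 : (evU A)ᴴ * XX t A B * evU B = Matrix.of fun i j =>
      ((cc A B i j / (cc A B i j + t) : ℝ) : ℂ) * ((evU A)ᴴ * evU B) i j := by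
    rw [XX, sum_SS_smul A B (fun c => ((c / (c + t) : ℝ) : ℂ))]
    rw [← Matrix.mul_assoc, ← Matrix.mul_assoc, evU_mul', Matrix.one_mul, Matrix.mul_assoc,
      evU_mul', Matrix.mul_one]
  rw [h1]
  rw [add_eq_left]
  refine Finset.sum_eq_zero fun i _ => Finset.sum_eq_zero fun j _ => ?_
  rw [Matrix.of_apply]
  by_cases hb : ev B j = 0
  · have h2 := supp_cond hA hB hle i j hb
    rcases mul_eq_zero.mp h2 with h | h
    · have : ev A i = 0 := by exact_mod_cast h
      simp [this, hb]
    · simp [h]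
  · have hb' : 0 < ev B j := lt_of_le_of_ne (ev_nonneg hB j) (Ne.symm hb)
    have ha := ev_nonneg hA i
    have : cc A B i j / (cc A B i j + t) = ev A i / (ev A i + t * ev B j) := by
      rw [cc]
      have h3 : ev A i + t * ev B j ≠ 0 := by positivity
      have h4 : ev A i / ev B j + t ≠ 0 := by positivity
      field_simp
    rw [this]; simp

theorem relent_sum_le {κ : Type*} [Fintype κ] (C D : κ → Matrix n n ℂ)
    (hC : ∀ k, (C k).PosSemidef) (hD : ∀ k, (D k).PosSemidef)
    (hle : ∀ k, (D k - C k).PosSemidef) :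
    REl (∑ k, C k) (∑ k, D k) ≤ ∑ k, REl (C k) (D k) ∧
    (∑ k, REl (C k) (D k) = REl (∑ k, C k) (∑ k, D k) →
      ∀ t : ℝ, 0 < t → ∑ k, FF t (C k) (D k) = FF t (∑ k, C k) (∑ k, D k)) := by
  have hC' : (∑ k, C k).PosSemidef := Matrix.posSemidef_sum _ fun k _ => hC k
  have hD' : (∑ k, D k).PosSemidef := Matrix.posSemidef_sum _ fun k _ => hD k
  have hle' : (∑ k, D k - ∑ k, C k).PosSemidef := by
    rw [← Finset.sum_sub_distrib]
    exact Matrix.posSemidef_sum _ fun k _ => hle k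
  set g : ℝ → ℝ := fun t => ∑ k, GG (C k) (D k) t - GG (∑ k, C k) (∑ k, D k) t with hg
  have hcont : ContinuousOn g (Set.Ici 0) :=
    (continuousOn_finsetSum _ fun k _ => GG_cont (hC k) (hD k) (hle k)).sub
      (GG_cont hC' hD' hle')
  have hder : ∀ t, 0 < t → HasDerivAt g
      (∑ k, FF t (C k) (D k) / t - FF t (∑ k, C k) (∑ k, D k) / t) t := fun t ht =>
    (HasDerivAt.fun_sum fun k _ => GG_deriv (hC k) (hD k) (hle k) t ht).sub
      (GG_deriv hC' hD' hle' t ht)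
  have hFF : ∀ t, 0 < t → ∑ k, FF t (C k) (D k) ≤ FF t (∑ k, C k) (∑ k, D k) := by
    intro t ht
    rw [← QF_XX t ht hC' hD' hle', QF_sum]
    exact Finset.sum_le_sum fun k _ => FF_le_QF t ht (hC k) (hD k) _
  have hanti : AntitoneOn g (Set.Ici 0) := by
    refine antitoneOn_of_deriv_nonpos (convex_Ici 0) hcont ?_ ?_
    · intro t ht
      rw [interior_Ici] at ht
      exact (hder t ht).differentiableAt.differentiableWithinAt
    · intro t ht
      rw [interior_Ici] at ht
      have ht' : (0:ℝ) < t := ht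
      rw [(hder t ht).deriv, ← Finset.sum_div, ← sub_div]
      exact div_nonpos_of_nonpos_of_nonneg (sub_nonpos.mpr (hFF t ht)) ht'.le
  have hlim : Filter.Tendsto g Filter.atTop (nhds 0) := by
    have h1 : Filter.Tendsto (fun t => ∑ k, (GG (C k) (D k) t - (C k).trace.re * Real.log t)
        - (GG (∑ k, C k) (∑ k, D k) t - (∑ k, C k).trace.re * Real.log t))
        Filter.atTop (nhds ((∑ k : κ, (0:ℝ)) - 0)) :=
      (tendsto_finsetSum _ fun k _ => GG_lim (hC k).1 (D k)).sub (GG_lim hC'.1 _)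
    simp only [Finset.sum_const_zero, sub_zero] at h1
    refine h1.congr fun t => ?_
    rw [hg, Matrix.trace_sum, Complex.re_sum, Finset.sum_sub_distrib, Finset.sum_mul]
    ring
  have hge : ∀ t, 0 ≤ t → 0 ≤ g t := by
    intro t ht
    refine le_of_tendsto hlim ?_
    filter_upwards [Filter.eventually_ge_atTop t] with s hs
    exact hanti ht (ht.trans hs) hs
  have hg0 : g 0 = ∑ k, REl (C k) (D k) - REl (∑ k, C k) (∑ k, D k) := by
    rw [hg]
    simp only [GG_zero hC' hD' hle', fun k => GG_zero (hC k) (hD k) (hle k)]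
  refine ⟨by have := hge 0 le_rfl; rw [hg0] at this; linarith, ?_⟩
  intro heq t ht
  have hz : ∀ s, 0 ≤ s → g s = 0 := by
    intro s hs
    refine le_antisymm ?_ (hge s hs)
    have := hanti (Set.mem_Ici.mpr le_rfl) hs hs
    rw [hg0, heq, sub_self] at this
    exact this
  have h1 : HasDerivAt g 0 t := by
    refine (hasDerivAt_const t (0:ℝ)).congr_of_eventuallyEq ?_
    filter_upwards [lt_mem_nhds ht] with s hs
    exact hz s hs.le
  have h2 := h1.unique (hder t ht)
  rw [← Finset.sum_div, ← sub_div] at h2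
  have h3 := (div_eq_zero_iff.mp h2.symm).resolve_right ht.ne'
  linarith

theorem relent_eq {κ : Type*} [Fintype κ] (C D : κ → Matrix n n ℂ)
    (hC : ∀ k, (C k).PosSemidef) (hD : ∀ k, (D k).PosSemidef)
    (hle : ∀ k, (D k - C k).PosSemidef)
    (heq : ∑ k, REl (C k) (D k) = REl (∑ k, C k) (∑ k, D k)) :
    ∃ (s : Finset ℝ) (S : ℝ → Matrix n n ℂ), (∀ c ∈ s, 0 ≤ c) ∧ ∑ c ∈ s, S c = 1 ∧
      ∀ k, ∀ c ∈ s, C k * S c = (c : ℂ) • (S c * D k) := by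
  have hC' : (∑ k, C k).PosSemidef := Matrix.posSemidef_sum _ fun k _ => hC k
  have hD' : (∑ k, D k).PosSemidef := Matrix.posSemidef_sum _ fun k _ => hD k
  have hle' : (∑ k, D k - ∑ k, C k).PosSemidef := by
    rw [← Finset.sum_sub_distrib]
    exact Matrix.posSemidef_sum _ fun k _ => hle k
  have hFF := (relent_sum_le C D hC hD hle).2 heq
  set A := ∑ k, C k with hA
  set B := ∑ k, D k with hB
  have hpos : ∀ c ∈ sC A B, 0 ≤ c := by
    intro c hc
    obtain ⟨ij, _, rfl⟩ := Finset.mem_image.mp hc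
    exact cc_nonneg hC' hD' _ _
  refine ⟨sC A B, SS A B, hpos, sum_SS A B, ?_⟩
  intro k
  have hX : ∀ t : ℝ, 0 < t → C k * XX t A B + (t : ℂ) • (XX t A B * D k) = C k := by
    intro t ht
    apply eq_of_QF_eq t ht (hC k) (hD k)
    have h1 : ∑ k, QF t (C k) (D k) (XX t A B) = ∑ k, FF t (C k) (D k) := by
      rw [← QF_sum, hFF t ht, ← QF_XX t ht hC' hD' hle']
    have h2 := (Finset.sum_eq_sum_iff_of_le
      (fun k _ => FF_le_QF t ht (hC k) (hD k) (XX t A B))).mp h1.symm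
    exact (h2 k (Finset.mem_univ k)).symm
  have hent : ∀ i j, ∀ c ∈ sC A B, (C k * SS A B c - (c : ℂ) • (SS A B c * D k)) i j = 0 := by
    intro i j
    apply resolvent_indep (sC A B) hpos
      (fun c => (C k * SS A B c - (c : ℂ) • (SS A B c * D k)) i j)
    intro t ht
    have h1 : ∑ c ∈ sC A B, ((t : ℂ) / ((c : ℂ) + t)) •
        (C k * SS A B c - (c : ℂ) • (SS A B c * D k)) = 0 := by
      have h2 := hX t ht
      have h3 : C k = ∑ c ∈ sC A B, C k * SS A B c := by
        rw [← Finset.mul_sum, sum_SS, Matrix.mul_one]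
      have h4 : C k * XX t A B + (t : ℂ) • (XX t A B * D k)
          = ∑ c ∈ sC A B, (((c / (c + t) : ℝ) : ℂ) • (C k * SS A B c)
            + ((t : ℂ) * ((c / (c + t) : ℝ) : ℂ)) • (SS A B c * D k)) := by
        rw [XX, Finset.mul_sum, Finset.sum_mul, Finset.smul_sum, ← Finset.sum_add_distrib]
        refine Finset.sum_congr rfl fun c _ => ?_
        rw [Matrix.mul_smul, Matrix.smul_mul, smul_smul]
      rw [h4] at h2
      have h5 : ∑ c ∈ sC A B, (C k * SS A B c - (((c / (c + t) : ℝ) : ℂ) • (C k * SS A B c)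
            + ((t : ℂ) * ((c / (c + t) : ℝ) : ℂ)) • (SS A B c * D k))) = 0 := by
        rw [Finset.sum_sub_distrib, h2, ← h3, sub_self]
      rw [← h5]
      refine Finset.sum_congr rfl fun c hc => ?_
      have hne : (c : ℂ) + t ≠ 0 := by
        have : 0 < c + t := by have := hpos c hc; linarith
        exact_mod_cast this.ne'
      ext a b
      simp only [Matrix.sub_apply, Matrix.add_apply, Matrix.smul_apply, smul_eq_mul]
      push_cast
      field_simp
      ring
    have h2 := congrFun (congrFun h1 i) j
    rw [Matrix.sum_apply] at h2
    have h3 : (t : ℂ) * ∑ c ∈ sC A B,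
        (C k * SS A B c - (c : ℂ) • (SS A B c * D k)) i j / ((c : ℂ) + t) = 0 := by
      rw [Finset.mul_sum, ← h2.trans (Matrix.zero_apply i j)]
      refine Finset.sum_congr rfl fun c _ => ?_
      rw [Matrix.smul_apply, smul_eq_mul]; ring
    exact (mul_eq_zero.mp h3).resolve_left (by exact_mod_cast ht.ne')
  intro c hc
  ext i j
  have := hent i j c hc
  rw [Matrix.sub_apply] at this
  exact sub_eq_zero.mp this

end Analysis3

section Entropy
variable {n : Type*} [Fintype n] [DecidableEq n]

lemma vnEnt_smul_aux {A : Matrix n n ℂ} (h : A.IsHermitian) (q : ℝ) :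
    vnEnt ((q : ℂ) • A) = -∑ i, (q * ev A i) * Real.log (q * ev A i) := by
  have hq : ((q : ℂ) • A).IsHermitian := by
    unfold Matrix.IsHermitian
    rw [conjTranspose_smul, h.eq]; simp
  rw [vnEnt_eq]
  congr 1
  set A' := (q : ℂ) • A with hA'
  set W := (evU A)ᴴ * evU A' with hW
  have h1 : diagonal (fun i => ((q * ev A i : ℝ) : ℂ)) * W
      = W * diagonal (fun i => (ev A' i : ℂ)) := by
    have e1 : diagonal (fun i => ((q * ev A i : ℝ) : ℂ))
        = (q : ℂ) • diagonal (fun i => (ev A i : ℂ)) := by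
      rw [← Matrix.diagonal_smul]; congr 1; ext i; simp
    have e2 : (evU A)ᴴ * A' = diagonal (fun i => ((q * ev A i : ℝ) : ℂ)) * (evU A)ᴴ := by
      rw [e1, hA', Matrix.mul_smul, evU_left h, Matrix.smul_mul]
    rw [hW, Matrix.mul_assoc, ← evU_right hq, ← Matrix.mul_assoc, ← Matrix.mul_assoc, e2]
  have hrow : ∀ i, ∑ j, Complex.normSq (W i j) = 1 := by
    have h : W * Wᴴ = 1 := by
      rw [hW, conjTranspose_mul, conjTranspose_conjTranspose, Matrix.mul_assoc,
        ← Matrix.mul_assoc (evU A'), evU_mul, Matrix.one_mul, evU_mul']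
    intro i
    have h1 := congrFun (congrFun h i) i
    rw [Matrix.mul_apply, Matrix.one_apply_eq] at h1
    have : ((∑ j, Complex.normSq (W i j) : ℝ) : ℂ) = 1 := by
      rw [← h1]
      push_cast
      refine Finset.sum_congr rfl fun j _ => ?_
      rw [Matrix.conjTranspose_apply, Complex.star_def, Complex.mul_conj]
    exact_mod_cast this
  have hcol : ∀ j, ∑ i, Complex.normSq (W i j) = 1 := by
    have h : Wᴴ * W = 1 := by
      rw [hW, conjTranspose_mul, conjTranspose_conjTranspose, Matrix.mul_assoc,
        ← Matrix.mul_assoc (evU A), evU_mul, Matrix.one_mul, evU_mul']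
    intro j
    have h1 := congrFun (congrFun h j) j
    rw [Matrix.mul_apply, Matrix.one_apply_eq] at h1
    have : ((∑ i, Complex.normSq (W i j) : ℝ) : ℂ) = 1 := by
      rw [← h1]
      push_cast
      refine Finset.sum_congr rfl fun i _ => ?_
      rw [Matrix.conjTranspose_apply, Complex.star_def, mul_comm, Complex.mul_conj]
    exact_mod_cast this
  have hl : ∑ j, ev A' j * Real.log (ev A' j)
      = ∑ j, ∑ i, Complex.normSq (W i j) * (ev A' j * Real.log (ev A' j)) := by
    refine Finset.sum_congr rfl fun j _ => ?_
    rw [← Finset.sum_mul, hcol, one_mul]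
  have hr : ∑ i, (q * ev A i) * Real.log (q * ev A i)
      = ∑ i, ∑ j, Complex.normSq (W i j) * ((q * ev A i) * Real.log (q * ev A i)) := by
    refine Finset.sum_congr rfl fun j _ => ?_
    rw [← Finset.sum_mul, hrow, one_mul]
  rw [hl, hr, Finset.sum_comm]
  refine Finset.sum_congr rfl fun i _ => Finset.sum_congr rfl fun j _ => ?_
  by_cases hz : W i j = 0
  · simp [hz]
  · have h2 := congrFun (congrFun h1 i) j
    rw [Matrix.diagonal_mul, Matrix.mul_diagonal, mul_comm] at h2
    have h3 := mul_left_cancel₀ hz h2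
    have h4 : q * ev A i = ev A' j := by exact_mod_cast h3
    rw [h4]

lemma vnEnt_smul {A : Matrix n n ℂ} (h : A.IsHermitian) (q : ℝ) :
    vnEnt ((q : ℂ) • A) = q * vnEnt A - q * Real.log q * A.trace.re := by
  rw [vnEnt_smul_aux h, vnEnt_eq, ← sum_ev h, Finset.mul_sum, mul_neg, Finset.mul_sum,
    ← Finset.sum_neg_distrib, ← Finset.sum_neg_distrib, ← Finset.sum_sub_distrib]
  refine Finset.sum_congr rfl fun i _ => ?_
  by_cases hq : q = 0
  · simp [hq]
  by_cases ha : ev A i = 0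
  · simp [ha]
  rw [Real.log_mul hq ha]
  ring

lemma vnEnt_zero : vnEnt (0 : Matrix n n ℂ) = 0 := by
  have := vnEnt_smul (A := (0 : Matrix n n ℂ)) (Matrix.isHermitian_zero) 0
  simpa using this

lemma condEntF_eq {𝒳 : Type*} [Fintype 𝒳] (p : 𝒳 → ℝ) (ρ : 𝒳 → Matrix n n ℂ)
    (h : ∀ x, p x ≠ 0 → (ρ x).IsHermitian ∧ (ρ x).trace.re = 1) :
    condEntF p ρ = ∑ x, vnEnt ((p x : ℂ) • ρ x) - vnEnt (∑ x, ((p x : ℝ) : ℂ) • ρ x) := by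
  rw [condEntF, shannonEnt]
  congr 1
  rw [← sub_eq_add_neg, ← Finset.sum_sub_distrib]
  refine Finset.sum_congr rfl fun x _ => ?_
  by_cases hx : p x = 0
  · simp [hx, vnEnt_zero]
  · rw [vnEnt_smul (h x hx).1, (h x hx).2, mul_one]

lemma marg_state {𝒴 : Type*} [Fintype 𝒴] (p : 𝒴 → ℝ) (ρ : 𝒴 → Matrix n n ℂ)
    (hp : ∀ y, 0 ≤ p y) (h : ∀ y, 0 < p y → IsState (ρ y)) :
    ((∑ y, p y) ≠ 0 → (((∑ y, p y : ℝ) : ℂ)⁻¹ • ∑ y, ((p y : ℝ) : ℂ) • ρ y).IsHermitian ∧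
      (((∑ y, p y : ℝ) : ℂ)⁻¹ • ∑ y, ((p y : ℝ) : ℂ) • ρ y).trace.re = 1) ∧
    ((∑ y, p y : ℝ) : ℂ) • (((∑ y, p y : ℝ) : ℂ)⁻¹ • ∑ y, ((p y : ℝ) : ℂ) • ρ y)
      = ∑ y, ((p y : ℝ) : ℂ) • ρ y := by
  have hherm : ∀ y, (((p y : ℝ) : ℂ) • ρ y).IsHermitian := by
    intro y
    rcases (hp y).eq_or_lt with h0 | h0
    · rw [← h0]; simp [Matrix.isHermitian_zero]
    · unfold Matrix.IsHermitian
      rw [conjTranspose_smul, (h y h0).1.1.eq]; simp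
  have htr : ∀ y, (((p y : ℝ) : ℂ) • ρ y).trace = p y := by
    intro y
    rcases (hp y).eq_or_lt with h0 | h0
    · rw [← h0]; simp
    · rw [Matrix.trace_smul, (h y h0).2]; simp
  have hs : (∑ y, ((p y : ℝ) : ℂ) • ρ y).IsHermitian := by
    unfold Matrix.IsHermitian
    rw [Matrix.conjTranspose_sum]
    exact Finset.sum_congr rfl fun y _ => (hherm y).eq
  refine ⟨fun hP => ⟨?_, ?_⟩, ?_⟩
  · unfold Matrix.IsHermitian
    rw [conjTranspose_smul, hs.eq, ← Complex.ofReal_inv]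
    simp only [Complex.star_def, Complex.conj_ofReal]
  · rw [Matrix.trace_smul, Matrix.trace_sum, Finset.sum_congr rfl fun y _ => htr y,
      ← Complex.ofReal_sum, smul_eq_mul, inv_mul_cancel₀ (by exact_mod_cast hP)]
    simp
  · by_cases hP : ∑ y, p y = 0
    · have : ∀ y, p y = 0 := by
        intro y
        exact (Finset.sum_eq_zero_iff_of_nonneg fun y _ => hp y).mp hP y (Finset.mem_univ y)
      simp [this]
    · rw [smul_smul, mul_inv_cancel₀ (by exact_mod_cast hP), one_smul]

lemma logm_self {A : Matrix n n ℂ} (h : A.IsHermitian) : (A * logm A).trace.re = - vnEnt A := by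
  have e : A * logm A = (evU A * diagonal (fun i => (ev A i : ℂ)) * (evU A)ᴴ) * logm A := by
    rw [← ev_spec h]
  rw [e, logm, vnEnt_eq, neg_neg]
  have : evU A * diagonal (fun i => (ev A i : ℂ)) * (evU A)ᴴ *
      (evU A * diagonal (fun j => ((Real.log (ev A j) : ℝ) : ℂ)) * (evU A)ᴴ)
      = evU A * (diagonal (fun i => (ev A i : ℂ)) *
        diagonal (fun j => ((Real.log (ev A j) : ℝ) : ℂ)) * (evU A)ᴴ) := by
    simp only [Matrix.mul_assoc]
    rw [← Matrix.mul_assoc (evU A)ᴴ (evU A), evU_mul', Matrix.one_mul]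
  rw [this, Matrix.trace_mul_comm, Matrix.mul_assoc, evU_mul', Matrix.mul_one,
    Matrix.diagonal_mul_diagonal, Matrix.trace_diagonal, Complex.re_sum]
  refine Finset.sum_congr rfl fun i _ => ?_
  rw [← Complex.ofReal_mul, Complex.ofReal_re]

/-- analytic part: vanishing of the conditional mutual information yields intertwiners. -/
theorem intertwiners_of_cmi {𝒳 𝒴 : Type*} [Fintype 𝒳] [Fintype 𝒴]
    (p : 𝒳 → 𝒴 → ℝ) (ρ : 𝒳 → 𝒴 → Matrix n n ℂ)
    (hp0 : ∀ x y, 0 ≤ p x y)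
    (hρ : ∀ x y, 0 < p x y → IsState (ρ x y))
    (hcmi : cmiF p ρ = 0) :
    (∀ x y, (((p x y : ℝ) : ℂ) • ρ x y).PosSemidef) ∧
    ∀ y, ∃ (s : Finset ℝ) (S : ℝ → Matrix n n ℂ), (∀ c ∈ s, 0 ≤ c) ∧ ∑ c ∈ s, S c = 1 ∧
      ∀ x, ∀ c ∈ s, (((p x y : ℝ) : ℂ) • ρ x y) * S c
        = (c : ℂ) • (S c * ∑ y', ((p x y' : ℝ) : ℂ) • ρ x y') := by
  set A : 𝒳 → 𝒴 → Matrix n n ℂ := fun x y => ((p x y : ℝ) : ℂ) • ρ x y with hA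
  have hpsd : ∀ x y, (A x y).PosSemidef := by
    intro x y
    rcases (hp0 x y).eq_or_lt with h0 | h0
    · simp only [hA, ← h0]; simpa using Matrix.PosSemidef.zero
    · exact (hρ x y h0).1.smul (by exact_mod_cast h0.le)
  refine ⟨hpsd, ?_⟩
  have hX : ∀ x, (∑ y, A x y).PosSemidef := fun x => Matrix.posSemidef_sum _ fun y _ => hpsd x y
  have hY : ∀ y, (∑ x, A x y).PosSemidef := fun y => Matrix.posSemidef_sum _ fun x _ => hpsd x y
  have hω : (∑ x, ∑ y, A x y).PosSemidef := Matrix.posSemidef_sum _ fun x _ => hX x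
  have hle : ∀ y x, (∑ y', A x y' - A x y).PosSemidef := by
    intro y x
    rw [← Finset.add_sum_erase _ _ (Finset.mem_univ y), add_sub_cancel_left]
    exact Matrix.posSemidef_sum _ fun y' _ => hpsd x y'
  have hent : ∑ x, vnEnt (∑ y, A x y) + ∑ y, vnEnt (∑ x, A x y) - vnEnt (∑ x, ∑ y, A x y)
      - ∑ x, ∑ y, vnEnt (A x y) = 0 := by
    rw [← hcmi, cmiF]
    have m1 := fun x => marg_state (p x) (ρ x) (hp0 x) (hρ x)
    have m2 := fun y => marg_state (fun x => p x y) (fun x => ρ x y) (fun x => hp0 x y)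
      (fun x => hρ x y)
    rw [condEntF_eq _ _ (fun x => (m1 x).1), condEntF_eq _ _ (fun y => (m2 y).1),
      condEntF_eq (fun xy : 𝒳 × 𝒴 => p xy.1 xy.2) (fun xy => ρ xy.1 xy.2)]
    · simp only [(m1 _).2, (m2 _).2, Fintype.sum_prod_type]
      rw [Finset.sum_comm (f := fun y x => ((p x y : ℝ) : ℂ) • ρ x y)]
      simp only [hA]
      ring
    · rintro ⟨x, y⟩ h
      have h0 : 0 < p x y := lt_of_le_of_ne (hp0 x y) (Ne.symm h)
      exact ⟨(hρ x y h0).1.1, by simp [(hρ x y h0).2]⟩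
  have hRE : ∑ y, (∑ x, REl (A x y) (∑ y', A x y')
      - REl (∑ x, A x y) (∑ x, ∑ y', A x y')) = 0 := by
    rw [← hent]
    simp only [REl, Finset.sum_sub_distrib, Finset.sum_neg_distrib]
    have e1 : ∑ y, ∑ x, (A x y * logm (∑ y', A x y')).trace.re = - ∑ x, vnEnt (∑ y, A x y) := by
      rw [Finset.sum_comm, ← Finset.sum_neg_distrib]
      refine Finset.sum_congr rfl fun x _ => ?_
      rw [← logm_self (hX x).1, ← Complex.re_sum, ← Matrix.trace_sum, ← Finset.sum_mul]
    have e2 : ∑ y, ((∑ x, A x y) * logm (∑ x, ∑ y', A x y')).trace.re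
        = - vnEnt (∑ x, ∑ y, A x y) := by
      rw [← logm_self hω.1, ← Complex.re_sum, ← Matrix.trace_sum, ← Finset.sum_mul,
        Finset.sum_comm]
    rw [e1, e2, Finset.sum_comm (f := fun y x => vnEnt (A x y))]
    ring
  have hnn : ∀ y, 0 ≤ ∑ x, REl (A x y) (∑ y', A x y')
      - REl (∑ x, A x y) (∑ x, ∑ y', A x y') := fun y =>
    sub_nonneg.mpr (relent_sum_le (fun x => A x y) (fun x => ∑ y', A x y')
      (fun x => hpsd x y) hX (hle y)).1
  intro y
  have h0 := (Finset.sum_eq_zero_iff_of_nonneg fun y _ => hnn y).mp hRE y (Finset.mem_univ y)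
  exact relent_eq (fun x => A x y) (fun x => ∑ y', A x y')
      (fun x => hpsd x y) hX (hle y) (sub_eq_zero.mp h0)

end Entropy

section Structure
universe u
variable {𝒳 : Type*}

/-- irreducibility: the commutant is trivial -/
def IsIrr {m : Type*} [Fintype m] [DecidableEq m] (A : 𝒳 → Matrix m m ℂ) : Prop :=
  ∀ M : Matrix m m ℂ, (∀ x, A x * M = M * A x) → ∃ c : ℂ, M = c • (1 : Matrix m m ℂ)

/-- orthogonal decomposition into irreducibles -/
def HasDec {n : Type u} [Fintype n] [DecidableEq n] (A : 𝒳 → Matrix n n ℂ) : Prop :=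
  ∃ (κ : Type) (_ : Fintype κ) (a : κ → ℕ) (J : ∀ k, Matrix n (Fin (a k)) ℂ)
    (Â : ∀ k, 𝒳 → Matrix (Fin (a k)) (Fin (a k)) ℂ),
    (∀ k, 0 < a k) ∧ (∀ k, (J k)ᴴ * J k = 1) ∧ (∀ k l, k ≠ l → (J k)ᴴ * J l = 0) ∧
    (∑ k, J k * (J k)ᴴ = 1) ∧ (∀ k x, A x * J k = J k * Â k x) ∧ ∀ k, IsIrr (Â k)

lemma nonscalar_herm {n : Type u} [Fintype n] [DecidableEq n] (A : 𝒳 → Matrix n n ℂ)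
    (hA : ∀ x, (A x).IsHermitian) (h : ¬ IsIrr A) :
    ∃ H : Matrix n n ℂ, H.IsHermitian ∧ (∀ x, A x * H = H * A x) ∧
      ∀ c : ℂ, H ≠ c • (1 : Matrix n n ℂ) := by
  unfold IsIrr at h
  push Not at h
  obtain ⟨M, hM, hns⟩ := h
  have hM' : ∀ x, A x * Mᴴ = Mᴴ * A x := by
    intro x
    have := congrArg conjTranspose (hM x)
    rw [conjTranspose_mul, conjTranspose_mul, (hA x).eq] at this
    exact this.symm
  by_cases h1 : ∃ c : ℂ, M + Mᴴ = c • (1 : Matrix n n ℂ)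
  · obtain ⟨c, hc⟩ := h1
    refine ⟨Complex.I • (M - Mᴴ), ?_, ?_, ?_⟩
    · unfold Matrix.IsHermitian
      rw [conjTranspose_smul, conjTranspose_sub, conjTranspose_conjTranspose]
      simp only [Complex.star_def, Complex.conj_I, neg_smul]
      rw [← smul_neg, neg_sub]
    · intro x
      rw [Matrix.mul_smul, Matrix.smul_mul, Matrix.mul_sub, Matrix.sub_mul, hM, hM']
    · intro c' hc'
      apply hns ((c - Complex.I * c') / 2)
      have e1 : M - Mᴴ = (-Complex.I * c') • (1 : Matrix n n ℂ) := by
        rw [← smul_smul, ← hc', smul_smul]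
        simp
      have e2 : M = (1 / 2 : ℂ) • ((M + Mᴴ) + (M - Mᴴ)) := by
        ext i j
        simp only [Matrix.smul_apply, Matrix.add_apply, Matrix.sub_apply, smul_eq_mul]
        ring
      rw [e2, hc, e1, ← add_smul, smul_smul]
      congr 1
      ring
  · push Not at h1
    refine ⟨M + Mᴴ, ?_, ?_, h1⟩
    · unfold Matrix.IsHermitian
      rw [conjTranspose_add, conjTranspose_conjTranspose, add_comm]
    · intro x
      rw [Matrix.mul_add, Matrix.add_mul, hM, hM']

/-- columns selected by a predicate -/
def selJ {n : Type u} (W : Matrix n n ℂ) (q : n → Prop) : Matrix n {i // q i} ℂ :=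
  W.submatrix id Subtype.val

lemma selJ_mul {n : Type u} [Fintype n] [DecidableEq n] (W B : Matrix n n ℂ) (q q' : n → Prop) :
    (selJ W q)ᴴ * B * selJ W q' = (Wᴴ * B * W).submatrix Subtype.val Subtype.val := by
  ext i j
  simp [selJ, Matrix.mul_apply]

lemma selJ_complete {n : Type u} [Fintype n] [DecidableEq n] (W : Matrix n n ℂ)
    (hW : W * Wᴴ = 1) (q : n → Prop) :
    selJ W q * (selJ W q)ᴴ + selJ W (fun i => ¬ q i) * (selJ W (fun i => ¬ q i))ᴴ = 1 := by
  rw [← hW]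
  ext i j
  simp only [selJ, Matrix.add_apply, Matrix.mul_apply, conjTranspose_apply, submatrix_apply, id]
  exact Fintype.sum_subtype_add_sum_subtype q (fun k => W i k * star (W j k))

lemma hasDec_of_split {n n₁ n₂ : Type u} [Fintype n] [DecidableEq n] [Fintype n₁] [DecidableEq n₁]
    [Fintype n₂] [DecidableEq n₂] (A : 𝒳 → Matrix n n ℂ) (J₁ : Matrix n n₁ ℂ) (J₂ : Matrix n n₂ ℂ)
    (A₁ : 𝒳 → Matrix n₁ n₁ ℂ) (A₂ : 𝒳 → Matrix n₂ n₂ ℂ)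
    (h1 : J₁ᴴ * J₁ = 1) (h2 : J₂ᴴ * J₂ = 1) (h12 : J₁ᴴ * J₂ = 0) (h21 : J₂ᴴ * J₁ = 0)
    (hc : J₁ * J₁ᴴ + J₂ * J₂ᴴ = 1) (hA1 : ∀ x, A x * J₁ = J₁ * A₁ x)
    (hA2 : ∀ x, A x * J₂ = J₂ * A₂ x) (d1 : HasDec A₁) (d2 : HasDec A₂) : HasDec A := by
  obtain ⟨κ, _, a, J, Â, p1, p2, p3, p4, p5, p6⟩ := d1
  obtain ⟨κ', _, a', J', Â', p1', p2', p3', p4', p5', p6'⟩ := d2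
  have aux : ∀ {α β γ δ : Type u} {ε ζ : Type} [Fintype α] [Fintype β] [Fintype γ]
      (P : Matrix α β ℂ) (Q : Matrix α γ ℂ) (R : Matrix β ε ℂ) (T : Matrix γ ζ ℂ),
      (P * R)ᴴ * (Q * T) = Rᴴ * (Pᴴ * Q) * T := by
    intros
    simp only [conjTranspose_mul, Matrix.mul_assoc]
  refine ⟨κ ⊕ κ', inferInstance, Sum.elim a a',
    fun k => match k with
      | Sum.inl k => J₁ * J k
      | Sum.inr k => J₂ * J' k,
    fun k => match k with
      | Sum.inl k => Â k
      | Sum.inr k => Â' k, ?_, ?_, ?_, ?_, ?_, ?_⟩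
  · rintro (k | k)
    · exact p1 k
    · exact p1' k
  · rintro (k | k)
    · show (J₁ * J k)ᴴ * (J₁ * J k) = 1
      rw [conjTranspose_mul, Matrix.mul_assoc, ← Matrix.mul_assoc J₁ᴴ, h1, Matrix.one_mul, p2]
    · show (J₂ * J' k)ᴴ * (J₂ * J' k) = 1
      rw [conjTranspose_mul, Matrix.mul_assoc, ← Matrix.mul_assoc J₂ᴴ, h2, Matrix.one_mul, p2']
  · rintro (k | k) (l | l) hkl
    · show (J₁ * J k)ᴴ * (J₁ * J l) = 0
      rw [conjTranspose_mul, Matrix.mul_assoc, ← Matrix.mul_assoc J₁ᴴ, h1, Matrix.one_mul, p3]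
      exact fun h => hkl (by rw [h])
    · show (J₁ * J k)ᴴ * (J₂ * J' l) = 0
      rw [conjTranspose_mul, Matrix.mul_assoc, ← Matrix.mul_assoc J₁ᴴ, h12, Matrix.zero_mul,
        Matrix.mul_zero]
    · show (J₂ * J' k)ᴴ * (J₁ * J l) = 0
      rw [conjTranspose_mul, Matrix.mul_assoc, ← Matrix.mul_assoc J₂ᴴ, h21, Matrix.zero_mul,
        Matrix.mul_zero]
    · show (J₂ * J' k)ᴴ * (J₂ * J' l) = 0
      rw [conjTranspose_mul, Matrix.mul_assoc, ← Matrix.mul_assoc J₂ᴴ, h2, Matrix.one_mul, p3']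
      exact fun h => hkl (by rw [h])
  · rw [Fintype.sum_sum_type]
    show ∑ k, (J₁ * J k) * (J₁ * J k)ᴴ + ∑ k, (J₂ * J' k) * (J₂ * J' k)ᴴ = 1
    have e1 : ∑ k, (J₁ * J k) * (J₁ * J k)ᴴ = J₁ * J₁ᴴ := by
      have : ∀ k, (J₁ * J k) * (J₁ * J k)ᴴ = J₁ * (J k * (J k)ᴴ) * J₁ᴴ := by
        intro k; simp only [conjTranspose_mul, Matrix.mul_assoc]
      rw [Finset.sum_congr rfl fun k _ => this k, ← Matrix.sum_mul, ← Matrix.mul_sum, p4,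
        Matrix.mul_one]
    have e2 : ∑ k, (J₂ * J' k) * (J₂ * J' k)ᴴ = J₂ * J₂ᴴ := by
      have : ∀ k, (J₂ * J' k) * (J₂ * J' k)ᴴ = J₂ * (J' k * (J' k)ᴴ) * J₂ᴴ := by
        intro k; simp only [conjTranspose_mul, Matrix.mul_assoc]
      rw [Finset.sum_congr rfl fun k _ => this k, ← Matrix.sum_mul, ← Matrix.mul_sum, p4',
        Matrix.mul_one]
    rw [e1, e2, hc]
  · rintro (k | k) x
    · show A x * (J₁ * J k) = (J₁ * J k) * Â k x
      rw [← Matrix.mul_assoc, hA1, Matrix.mul_assoc, p5, Matrix.mul_assoc]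
    · show A x * (J₂ * J' k) = (J₂ * J' k) * Â' k x
      rw [← Matrix.mul_assoc, hA2, Matrix.mul_assoc, p5', Matrix.mul_assoc]
  · rintro (k | k)
    · exact p6 k
    · exact p6' k

lemma hasDec_all (N : ℕ) : ∀ (n : Type u) [Fintype n] [DecidableEq n] (A : 𝒳 → Matrix n n ℂ),
    Fintype.card n = N → (∀ x, (A x).IsHermitian) → HasDec A := by
  induction N using Nat.strong_induction_on with
  | _ N ih =>
  intro n _ _ A hN hA
  by_cases hirr : IsIrr A
  · by_cases hne : Nonempty n
    · let e : n ≃ Fin (Fintype.card n) := Fintype.equivFin n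
      refine ⟨Unit, inferInstance, fun _ => Fintype.card n,
        fun _ => (1 : Matrix n n ℂ).submatrix id e.symm,
        fun _ x => (A x).submatrix e.symm e.symm, ?_, ?_, ?_, ?_, ?_, ?_⟩
      · intro _; exact Fintype.card_pos
      · intro _
        rw [conjTranspose_submatrix, conjTranspose_one,
          ← Matrix.submatrix_mul (1 : Matrix n n ℂ) 1 e.symm id e.symm Function.bijective_id]
        rw [Matrix.mul_one]; exact Matrix.submatrix_one_equiv _
      · intro k l h; exact absurd rfl h
      · simp only [Finset.univ_unique, Finset.sum_singleton]
        rw [conjTranspose_submatrix, conjTranspose_one,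
          ← Matrix.submatrix_mul (1 : Matrix n n ℂ) 1 id e.symm id e.symm.bijective]
        simp
      · intro _ x
        have : A x = (A x).submatrix id id := by simp
        conv_lhs => rw [this]
        rw [← Matrix.submatrix_mul (A x) 1 id id e.symm Function.bijective_id,
          ← Matrix.submatrix_mul 1 (A x) id e.symm e.symm e.symm.bijective]
        simp
      · intro _ M hM
        obtain ⟨c, hc⟩ := hirr (M.submatrix e e) (by
          intro x
          have := congrArg (fun Z => Z.submatrix e e) (hM x)
          simp only at this
          rw [← Matrix.submatrix_mul_equiv _ _ e e e, ← Matrix.submatrix_mul_equiv _ _ e e e] at this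
          simpa using this)
        refine ⟨c, ?_⟩
        have := congrArg (fun Z => Z.submatrix e.symm e.symm) hc
        rw [Matrix.submatrix_smul] at this
        simpa using this
    · have : IsEmpty n := not_nonempty_iff.mp hne
      refine ⟨Empty, inferInstance, fun k => k.elim, fun k => k.elim, fun k => k.elim,
        fun k => k.elim, fun k => k.elim, fun k => k.elim, ?_, fun k => k.elim, fun k => k.elim⟩
      exact Subsingleton.elim _ _
  · obtain ⟨H, hH, hcomm, hns⟩ := nonscalar_herm A hA hirr
    obtain ⟨i0, j0, hij⟩ : ∃ i j, ev H i ≠ ev H j := by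
      by_contra hcon
      push Not at hcon
      by_cases hne : Nonempty n
      · obtain ⟨i⟩ := hne
        apply hns (ev H i)
        have h1 := ev_spec hH
        have h2 : diagonal (fun j => (ev H j : ℂ)) = (ev H i : ℂ) • (1 : Matrix n n ℂ) := by
          rw [← Matrix.diagonal_one, ← Matrix.diagonal_smul]
          congr 1
          ext j
          simp [hcon j i]
        rw [h2, Matrix.mul_smul, Matrix.smul_mul, Matrix.mul_one, evU_mul] at h1
        exact h1
      · have : IsEmpty n := not_nonempty_iff.mp hne
        exact hns 0 (Subsingleton.elim _ _)
    set W := evU H with hW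
    set q : n → Prop := fun i => ev H i = ev H i0 with hq
    have hoff : ∀ x i j, ev H i ≠ ev H j → (Wᴴ * A x * W) i j = 0 := by
      intro x i j hne
      have h1 : diagonal (fun i => (ev H i : ℂ)) * (Wᴴ * A x * W)
          = (Wᴴ * A x * W) * diagonal (fun i => (ev H i : ℂ)) := by
        rw [Matrix.mul_assoc (Wᴴ * A x), ← evU_right hH, Matrix.mul_assoc Wᴴ (A x),
          ← Matrix.mul_assoc, ← evU_left hH]
        simp only [Matrix.mul_assoc]
        rw [← Matrix.mul_assoc H, ← hcomm x, Matrix.mul_assoc]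
      have h2 := congrFun (congrFun h1 i) j
      rw [Matrix.diagonal_mul, Matrix.mul_diagonal] at h2
      have h3 : ((ev H i : ℂ) - ev H j) * (Wᴴ * A x * W) i j = 0 := by linear_combination h2
      rcases mul_eq_zero.mp h3 with h | h
      · exfalso; apply hne
        have : (ev H i : ℂ) = ev H j := by linear_combination h
        exact_mod_cast this
      · exact h
    have hWW : Wᴴ * W = 1 := evU_mul' H
    have hsel : ∀ q q' : n → Prop, (selJ W q)ᴴ * selJ W q'
        = (1 : Matrix n n ℂ).submatrix Subtype.val Subtype.val := by
      intro q q'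
      have := selJ_mul W 1 q q'
      rwa [Matrix.mul_one, Matrix.mul_one, hWW] at this
    have hone : ∀ q : n → Prop, (selJ W q)ᴴ * selJ W q = 1 := by
      intro q
      rw [hsel]
      exact Matrix.submatrix_one _ Subtype.val_injective
    have hcompl := selJ_complete W (evU_mul H) q
    have h21 : (selJ W (fun i => ¬ q i))ᴴ * selJ W q = 0 := by
      rw [hsel]
      ext i j
      have : (i : n) ≠ j := fun h => i.2 (h ▸ j.2)
      simp [Matrix.one_apply, this]
    have h12 : (selJ W q)ᴴ * selJ W (fun i => ¬ q i) = 0 := by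
      have := congrArg conjTranspose h21
      rwa [conjTranspose_mul, conjTranspose_conjTranspose, conjTranspose_zero] at this
    have hA21 : ∀ x, (selJ W (fun i => ¬ q i))ᴴ * A x * selJ W q = 0 := by
      intro x
      rw [selJ_mul]
      ext i j
      rw [submatrix_apply, hoff, Matrix.zero_apply]
      intro h
      exact i.2 (h.trans j.2)
    have hA12 : ∀ x, (selJ W q)ᴴ * A x * selJ W (fun i => ¬ q i) = 0 := by
      intro x
      rw [selJ_mul]
      ext i j
      rw [submatrix_apply, hoff, Matrix.zero_apply]
      intro h
      exact j.2 (h.symm.trans i.2)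
    have hherm : ∀ (q : n → Prop) x, ((selJ W q)ᴴ * A x * selJ W q).IsHermitian := by
      intro q x
      unfold Matrix.IsHermitian
      rw [conjTranspose_mul, conjTranspose_mul, conjTranspose_conjTranspose, (hA x).eq,
        Matrix.mul_assoc]
    refine hasDec_of_split A (selJ W q) (selJ W (fun i => ¬ q i))
      (fun x => (selJ W q)ᴴ * A x * selJ W q)
      (fun x => (selJ W (fun i => ¬ q i))ᴴ * A x * selJ W (fun i => ¬ q i))
      (hone _) (hone _) h12 h21 hcompl ?_ ?_ ?_ ?_
    · intro x
      conv_lhs => rw [← Matrix.one_mul (A x * _), ← hcompl]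
      rw [Matrix.add_mul, Matrix.mul_assoc (selJ W fun i => ¬ q i), ← Matrix.mul_assoc (_ᴴ) (A x),
        hA21, Matrix.mul_zero, add_zero]
      simp only [Matrix.mul_assoc]
    · intro x
      conv_lhs => rw [← Matrix.one_mul (A x * _), ← hcompl]
      rw [Matrix.add_mul, Matrix.mul_assoc (selJ W q), ← Matrix.mul_assoc (_ᴴ) (A x),
        hA12, Matrix.mul_zero, zero_add]
      simp only [Matrix.mul_assoc]
    · refine ih _ ?_ _ _ rfl (hherm _)
      rw [← hN]
      exact Fintype.card_subtype_lt (x := j0) (fun h => hij h.symm)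
    · refine ih _ ?_ _ _ rfl (hherm _)
      rw [← hN]
      exact Fintype.card_subtype_lt (x := i0) (fun h => h rfl)

end Structure

section Schur
variable {𝒳 : Type*}

lemma schur_unitary {m k : Type*} [Fintype m] [DecidableEq m] [Fintype k] [DecidableEq k]
    (A : 𝒳 → Matrix m m ℂ) (B : 𝒳 → Matrix k k ℂ)
    (hA : ∀ x, (A x).IsHermitian) (hB : ∀ x, (B x).IsHermitian)
    (iA : IsIrr A) (iB : IsIrr B) (l : ℝ) (hl : 0 < l) (T : Matrix m k ℂ)
    (hT : ∀ x, A x * T = (l : ℂ) • (T * B x)) (hT0 : T ≠ 0) :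
    ∃ (z : ℂ) (u : Matrix m k ℂ), z ≠ 0 ∧ uᴴ * u = 1 ∧ u * uᴴ = 1 ∧ T = z • u := by
  have hlc : (l : ℂ) ≠ 0 := by exact_mod_cast hl.ne'
  have hT' : ∀ x, Tᴴ * A x = (l : ℂ) • (B x * Tᴴ) := by
    intro x
    have := congrArg conjTranspose (hT x)
    rw [conjTranspose_mul, conjTranspose_smul, conjTranspose_mul, (hA x).eq, (hB x).eq] at this
    simpa using this
  obtain ⟨s, hs⟩ := iB (Tᴴ * T) (by
    intro x
    have h1 : Tᴴ * A x * T = (l : ℂ) • (B x * (Tᴴ * T)) := by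
      rw [hT', Matrix.smul_mul, Matrix.mul_assoc]
    have h2 : Tᴴ * A x * T = (l : ℂ) • (Tᴴ * T * B x) := by
      rw [Matrix.mul_assoc, hT, Matrix.mul_smul, Matrix.mul_assoc]
    exact smul_right_injective _ hlc (h1.symm.trans h2))
  obtain ⟨s', hs'⟩ := iA (T * Tᴴ) (by
    intro x
    rw [← Matrix.mul_assoc, hT, Matrix.mul_assoc T, hT', Matrix.smul_mul, Matrix.mul_smul,
      Matrix.mul_assoc])
  have hss : s = s' := by
    have h1 : s • T = s' • T := by
      have h2 : T * (Tᴴ * T) = (T * Tᴴ) * T := by rw [Matrix.mul_assoc]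
      rw [hs, hs'] at h2
      simpa using h2
    exact smul_left_injective ℂ hT0 h1
  subst hss
  have hs0 : s ≠ 0 := by
    rintro rfl
    rw [zero_smul] at hs
    exact hT0 (Matrix.conjTranspose_mul_self_eq_zero.mp hs)
  have hne : Nonempty k := by
    by_contra h
    have : IsEmpty k := not_nonempty_iff.mp h
    exact hT0 (by ext i j; exact isEmptyElim j)
  obtain ⟨j⟩ := hne
  have hsn : 0 ≤ s := by
    have h1 := (Matrix.posSemidef_conjTranspose_mul_self T).diag_nonneg (i := j)
    rw [hs] at h1
    simpa using h1
  obtain ⟨t, ht⟩ : ∃ t : ℝ, (t : ℂ) = s := ⟨s.re, (Complex.eq_re_of_ofReal_le hsn).symm⟩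
  subst ht
  have ht0 : 0 < t := by
    have : 0 ≤ t := by exact_mod_cast hsn
    refine lt_of_le_of_ne this ?_
    rintro rfl
    simp at hs0
  have hq : Real.sqrt t ≠ 0 := (Real.sqrt_pos.mpr ht0).ne'
  have hqc : ((Real.sqrt t : ℝ) : ℂ) ≠ 0 := by exact_mod_cast hq
  have hqq : ((Real.sqrt t : ℝ) : ℂ)⁻¹ * ((Real.sqrt t : ℝ) : ℂ)⁻¹ * (t : ℂ) = 1 := by
    have : (t : ℂ) = ((Real.sqrt t : ℝ) : ℂ) * ((Real.sqrt t : ℝ) : ℂ) := by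
      rw [← Complex.ofReal_mul, Real.mul_self_sqrt ht0.le]
    rw [this]
    field_simp
  have hst : star (((Real.sqrt t : ℝ) : ℂ)⁻¹) = ((Real.sqrt t : ℝ) : ℂ)⁻¹ := by
    rw [star_inv₀]; simp
  refine ⟨(Real.sqrt t : ℝ), ((Real.sqrt t : ℝ) : ℂ)⁻¹ • T, hqc, ?_, ?_, ?_⟩
  · rw [conjTranspose_smul, hst, Matrix.smul_mul, Matrix.mul_smul, hs, smul_smul, smul_smul, hqq,
      one_smul]
  · rw [conjTranspose_smul, hst, Matrix.smul_mul, Matrix.mul_smul, hs', smul_smul, smul_smul, hqq,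
      one_smul]
  · rw [smul_smul, mul_inv_cancel₀ hqc, one_smul]

lemma schur_same {k : Type*} [Fintype k] [DecidableEq k]
    (B : 𝒳 → Matrix k k ℂ) (hB : ∀ x, (B x).PosSemidef) (iB : IsIrr B) (l : ℝ) (hl : 0 < l)
    (T : Matrix k k ℂ) (hT : ∀ x, B x * T = (l : ℂ) • (T * B x)) :
    ∃ c : ℂ, T = c • (1 : Matrix k k ℂ) := by
  by_cases hT0 : T = 0
  · exact ⟨0, by simp [hT0]⟩
  by_cases h1 : l = 1
  · subst h1
    exact iB T (by simpa using hT)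
  obtain ⟨z, u, hz, hu, hu', rfl⟩ := schur_unitary B B (fun x => (hB x).1) (fun x => (hB x).1)
    iB iB l hl T hT hT0
  apply iB
  intro x
  have h2 : B x * u = (l : ℂ) • (u * B x) := by
    have := hT x
    rw [Matrix.mul_smul, Matrix.smul_mul, smul_comm] at this
    exact smul_right_injective _ hz this
  have h3 : B x = (l : ℂ) • (u * B x * uᴴ) := by
    rw [← Matrix.smul_mul, ← h2, Matrix.mul_assoc, hu', Matrix.mul_one]
  have h4 : (B x).trace = (l : ℂ) * (B x).trace := by
    conv_lhs => rw [h3]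
    rw [Matrix.trace_smul, Matrix.trace_mul_comm, ← Matrix.mul_assoc, hu, Matrix.one_mul,
      smul_eq_mul]
  have h5 : (B x).trace = 0 := by
    have : (1 - (l : ℂ)) * (B x).trace = 0 := by rw [sub_mul, one_mul, ← h4, sub_self]
    rcases mul_eq_zero.mp this with h | h
    · exfalso
      apply h1
      have := sub_eq_zero.mp h
      exact_mod_cast this.symm
    · exact h
  have h6 : B x = 0 := (hB x).trace_eq_zero_iff.mp h5
  rw [h6]; simp

/-- multiplicity form of the decomposition into irreducibles, up to scalars -/
lemma classes {n : Type*} [Fintype n] [DecidableEq n] (A : 𝒳 → Matrix n n ℂ)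
    (hA : ∀ x, (A x).PosSemidef) :
    ∃ (N : ℕ) (a b : Fin N → ℕ) (Â : ∀ i, 𝒳 → Matrix (Fin (a i)) (Fin (a i)) ℂ)
      (L : ∀ i, Fin (b i) → Matrix n (Fin (a i)) ℂ) (lam : ∀ i, Fin (b i) → ℝ),
      (∀ i, 0 < a i) ∧ (∀ i, 0 < b i) ∧ (∀ i x, (Â i x).PosSemidef) ∧ (∀ i, IsIrr (Â i)) ∧
      (∀ i j, 0 < lam i j) ∧ (∀ i j, (L i j)ᴴ * L i j = 1) ∧
      (∀ i j j', j ≠ j' → (L i j)ᴴ * L i j' = 0) ∧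
      (∀ i i', i ≠ i' → ∀ j j', (L i j)ᴴ * L i' j' = 0) ∧
      (∑ i, ∑ j, L i j * (L i j)ᴴ = 1) ∧
      (∀ i j x, A x * L i j = (lam i j : ℂ) • (L i j * Â i x)) ∧
      (∀ i i', i ≠ i' → ∀ (l : ℝ), 0 < l → ∀ T : Matrix (Fin (a i)) (Fin (a i')) ℂ,
        (∀ x, Â i x * T = (l : ℂ) • (T * Â i' x)) → T = 0) := by
  obtain ⟨κ, _, a, J, Â, ha, hJ, hJJ, hJs, hAJ, hirr⟩ :=
    hasDec_all (Fintype.card n) n A rfl (fun x => (hA x).1)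
  have hÂ : ∀ k x, Â k x = (J k)ᴴ * A x * J k := by
    intro k x
    rw [Matrix.mul_assoc, hAJ, ← Matrix.mul_assoc, hJ, Matrix.one_mul]
  have hpsd : ∀ k x, (Â k x).PosSemidef := by
    intro k x
    rw [hÂ]
    exact (hA x).conjTranspose_mul_mul_same _
  let R : κ → κ → Prop := fun k l => ∃ (c : ℝ) (u : Matrix (Fin (a k)) (Fin (a l)) ℂ), 0 < c ∧
    uᴴ * u = 1 ∧ u * uᴴ = 1 ∧ ∀ x, Â k x * u = (c : ℂ) • (u * Â l x)
  have hR : Equivalence R := by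
    refine ⟨?_, ?_, ?_⟩
    · intro k
      exact ⟨1, 1, one_pos, by simp, by simp, by simp⟩
    · rintro k l ⟨c, u, hc, h1, h2, h3⟩
      refine ⟨c⁻¹, uᴴ, inv_pos.mpr hc, by simpa using h2, by simpa using h1, ?_⟩
      intro x
      have hcc : (c : ℂ) ≠ 0 := by exact_mod_cast hc.ne'
      have h4 : uᴴ * (Â k x * u) * uᴴ = uᴴ * ((c : ℂ) • (u * Â l x)) * uᴴ := by rw [h3]
      rw [Matrix.mul_assoc, Matrix.mul_assoc (Â k x), h2, Matrix.mul_one, Matrix.mul_smul,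
        ← Matrix.mul_assoc uᴴ u, h1, Matrix.one_mul, Matrix.smul_mul] at h4
      rw [h4, smul_smul, Complex.ofReal_inv, inv_mul_cancel₀ hcc, one_smul]
    · rintro k l m ⟨c, u, hc, h1, h2, h3⟩ ⟨c', u', hc', h1', h2', h3'⟩
      refine ⟨c * c', u * u', mul_pos hc hc', ?_, ?_, ?_⟩
      · rw [conjTranspose_mul, Matrix.mul_assoc, ← Matrix.mul_assoc uᴴ, h1, Matrix.one_mul, h1']
      · rw [conjTranspose_mul, Matrix.mul_assoc, ← Matrix.mul_assoc u', h2', Matrix.one_mul, h2]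
      · intro x
        rw [← Matrix.mul_assoc, h3, Matrix.smul_mul, Matrix.mul_assoc u, h3', Matrix.mul_smul,
          smul_smul, ← Matrix.mul_assoc, Complex.ofReal_mul]
  let st : Setoid κ := ⟨R, hR⟩
  let N := Fintype.card (Quotient st)
  let qe : Quotient st ≃ Fin N := Fintype.equivFin _
  let g : κ → Fin N := fun k => qe (Quotient.mk st k)
  have hg : Function.Surjective g := qe.surjective.comp Quotient.mk_surjective
  choose rep hrep using hg
  have hgR : ∀ k l, g k = g l → R k l := by
    intro k l h
    exact Quotient.exact (qe.injective h)
  have hRg : ∀ k l, R k l → g k = g l := by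
    intro k l h
    exact congrArg qe (Quotient.sound h)
  let b : Fin N → ℕ := fun i => Fintype.card {k // g k = i}
  let be : ∀ i, Fin (b i) ≃ {k // g k = i} := fun i => (Fintype.equivFin _).symm
  have hch : ∀ i (k : {k // g k = i}), ∃ (c : ℝ) (u : Matrix (Fin (a k)) (Fin (a (rep i))) ℂ), 0 < c ∧
    uᴴ * u = 1 ∧ u * uᴴ = 1 ∧ ∀ x, Â k x * u = (c : ℂ) • (u * Â (rep i) x) := by
    intro i k
    exact hgR k (rep i) (k.2.trans (hrep i).symm)
  choose c u hc hu hu' hcu using hch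
  have horth : ∀ i i' (k : {k // g k = i}) (k' : {k // g k = i'}), k.1 ≠ k'.1 →
      (J k.1 * u i k)ᴴ * (J k'.1 * u i' k') = 0 := by
    intro i i' k k' h
    rw [conjTranspose_mul, Matrix.mul_assoc, ← Matrix.mul_assoc (J k.1)ᴴ, hJJ _ _ h]
    simp
  refine ⟨N, fun i => a (rep i), b, fun i => Â (rep i), fun i j => J (be i j).1 * u i (be i j),
    fun i j => c i (be i j), fun i => ha _, ?_, fun i => hpsd _, fun i => hirr _,
    fun i j => hc _ _, ?_, ?_, ?_, ?_, ?_, ?_⟩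
  · intro i
    exact Fintype.card_pos_iff.mpr ⟨⟨rep i, hrep i⟩⟩
  · intro i j
    rw [conjTranspose_mul, Matrix.mul_assoc, ← Matrix.mul_assoc (J _)ᴴ, hJ, Matrix.one_mul, hu]
  · intro i j j' h
    apply horth
    intro h'
    exact h ((be i).injective (Subtype.ext h'))
  · intro i i' h j j'
    apply horth
    intro h'
    apply h
    rw [← (be i j).2, ← (be i' j').2, h']
  · rw [← hJs, ← Fintype.sum_fiberwise g (fun k => J k * (J k)ᴴ)]
    refine Finset.sum_congr rfl fun i _ => ?_
    rw [← Equiv.sum_comp (be i)]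
    refine Finset.sum_congr rfl fun j _ => ?_
    rw [conjTranspose_mul, Matrix.mul_assoc, ← Matrix.mul_assoc (u _ _), hu', Matrix.one_mul]
  · intro i j x
    rw [← Matrix.mul_assoc, hAJ, Matrix.mul_assoc, hcu, Matrix.mul_smul, Matrix.mul_assoc]
  · intro i i' h l hl T hT
    by_contra hT0
    obtain ⟨z, v, hz, hv, hv', rfl⟩ := schur_unitary _ _ (fun x => (hpsd _ x).1)
      (fun x => (hpsd _ x).1) (hirr _) (hirr _) l hl T hT hT0
    apply h
    rw [← hrep i, ← hrep i']
    refine hRg _ _ ⟨l, v, hl, hv, hv', ?_⟩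
    intro x
    have := hT x
    rw [Matrix.mul_smul, Matrix.smul_mul, smul_comm] at this
    exact smul_right_injective _ hz this
end Schur

section Final
variable {𝒳 𝒴 : Type*}

/-- the block unitary -/
def bigW {n : Type*} {N : ℕ} {a b : Fin N → ℕ} (L : ∀ i, Fin (b i) → Matrix n (Fin (a i)) ℂ) :
    Matrix n (Σ i : Fin N, Fin (a i) × Fin (b i)) ℂ :=
  Matrix.of fun m s => L s.1 s.2.2 m s.2.1

lemma bigW_sandwich {n : Type*} [Fintype n] [DecidableEq n] {N : ℕ} {a b : Fin N → ℕ}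
    (L : ∀ i, Fin (b i) → Matrix n (Fin (a i)) ℂ) (M : Matrix n n ℂ)
    (s t : Σ i : Fin N, Fin (a i) × Fin (b i)) :
    ((bigW L)ᴴ * M * bigW L) s t = ((L s.1 s.2.2)ᴴ * M * L t.1 t.2.2) s.2.1 t.2.1 := by
  simp [bigW, Matrix.mul_apply]

lemma bigW_mul {n : Type*} [Fintype n] [DecidableEq n] {N : ℕ} {a b : Fin N → ℕ}
    (L : ∀ i, Fin (b i) → Matrix n (Fin (a i)) ℂ) :
    bigW L * (bigW L)ᴴ = ∑ i, ∑ j, L i j * (L i j)ᴴ := by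
  ext m m'
  rw [Matrix.mul_apply, Fintype.sum_sigma, Matrix.sum_apply]
  refine Finset.sum_congr rfl fun i _ => ?_
  rw [Fintype.sum_prod_type_right, Matrix.sum_apply]
  refine Finset.sum_congr rfl fun j _ => ?_
  rw [Matrix.mul_apply]
  rfl

lemma struct_aux [Fintype 𝒴] {n : Type*} [Fintype n] [DecidableEq n]
    (A : 𝒳 → 𝒴 → Matrix n n ℂ) (hA : ∀ x y, (A x y).PosSemidef)
    (hIntw : ∀ y, ∃ (s : Finset ℝ) (S : ℝ → Matrix n n ℂ), (∀ c ∈ s, 0 ≤ c) ∧ ∑ c ∈ s, S c = 1 ∧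
      ∀ x, ∀ c ∈ s, A x y * S c = (c : ℂ) • (S c * ∑ y', A x y')) :
    ∃ (N : ℕ) (a b : Fin N → ℕ) (Â : ∀ i, 𝒳 → Matrix (Fin (a i)) (Fin (a i)) ℂ)
      (H : ∀ i, 𝒴 → Matrix (Fin (b i)) (Fin (b i)) ℂ)
      (W : Matrix n (Σ i : Fin N, Fin (a i) × Fin (b i)) ℂ),
      (∀ i, 0 < a i) ∧ (∀ i, 0 < b i) ∧ (∀ i x, (Â i x).PosSemidef) ∧ Wᴴ * W = 1 ∧ W * Wᴴ = 1 ∧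
      ∀ x y, Wᴴ * A x y * W = Matrix.blockDiagonal' fun i => Â i x ⊗ₖ H i y := by
  have hAs : ∀ x, (∑ y, A x y).PosSemidef := fun x =>
    Matrix.posSemidef_sum _ (fun y _ => hA x y)
  obtain ⟨N, a, b, Â, L, lam, ha, hb, hÂ, hirr, hlam, hL1, hL2, hL3, hLs, hAL, hneq⟩ :=
    classes (fun x => ∑ y, A x y) hAs
  set W := bigW L with hW
  have hWW : W * Wᴴ = 1 := by rw [hW, bigW_mul, hLs]
  have hLA : ∀ i j x, (L i j)ᴴ * (∑ y, A x y) = (lam i j : ℂ) • (Â i x * (L i j)ᴴ) := by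
    intro i j x
    have := congrArg conjTranspose (hAL i j x)
    rw [conjTranspose_mul, conjTranspose_smul, conjTranspose_mul, (hAs x).1.eq, (hÂ i x).1.eq] at this
    simpa using this
  have hW1 : Wᴴ * W = 1 := by
    ext s t
    have := bigW_sandwich L 1 s t
    rw [Matrix.mul_one, Matrix.mul_one] at this
    rw [hW, this]
    obtain ⟨i, α, j⟩ := s
    obtain ⟨i', α', j'⟩ := t
    dsimp only
    by_cases h : i = i'
    · subst h
      by_cases h' : j = j'
      · subst h'
        rw [hL1]
        simp [Matrix.one_apply]
      · rw [hL2 _ _ _ h']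
        simp [Matrix.one_apply, h']
    · rw [hL3 _ _ h]
      simp [Matrix.one_apply, h]
  have hWA : ∀ x, Wᴴ * (∑ y, A x y) * W
      = Matrix.blockDiagonal' fun i => Â i x ⊗ₖ diagonal (fun j => (lam i j : ℂ)) := by
    intro x
    ext s t
    rw [hW, bigW_sandwich]
    obtain ⟨i, α, j⟩ := s
    obtain ⟨i', α', j'⟩ := t
    dsimp only
    rw [Matrix.mul_assoc, hAL, Matrix.mul_smul, ← Matrix.mul_assoc]
    by_cases h : i = i'
    · subst h
      rw [Matrix.blockDiagonal'_apply_eq, Matrix.kroneckerMap_apply]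
      by_cases h' : j = j'
      · subst h'
        rw [hL1]
        simp [mul_comm]
      · rw [hL2 _ _ _ h']
        simp [Matrix.diagonal_apply, h']
    · rw [hL3 _ _ h, Matrix.blockDiagonal'_apply_ne _ _ _ h]
      simp
  have hK : ∀ (l : ℝ) (K : Matrix n n ℂ), 0 < l →
      (∀ x, (∑ y, A x y) * K = (l : ℂ) • (K * ∑ y, A x y)) →
      ∃ G : ∀ i, Matrix (Fin (b i)) (Fin (b i)) ℂ, Wᴴ * K * W =
        Matrix.blockDiagonal' fun i => (1 : Matrix (Fin (a i)) (Fin (a i)) ℂ) ⊗ₖ G i := by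
    intro l K hl hK
    have hT : ∀ i j i' j' x, Â i x * ((L i j)ᴴ * K * L i' j')
        = ((l * lam i' j' / lam i j : ℝ) : ℂ) • (((L i j)ᴴ * K * L i' j') * Â i' x) := by
      intro i j i' j' x
      have hne : (lam i j : ℂ) ≠ 0 := by exact_mod_cast (hlam i j).ne'
      have e1 : (L i j)ᴴ * ((∑ y, A x y) * K) * L i' j'
          = (lam i j : ℂ) • (Â i x * ((L i j)ᴴ * K * L i' j')) := by
        rw [← Matrix.mul_assoc, hLA]
        simp only [Matrix.smul_mul, Matrix.mul_assoc]
      have e2 : (L i j)ᴴ * ((∑ y, A x y) * K) * L i' j'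
          = ((l : ℂ) * lam i' j') • (((L i j)ᴴ * K * L i' j') * Â i' x) := by
        rw [hK, Matrix.mul_smul, Matrix.smul_mul, Matrix.mul_assoc, Matrix.mul_assoc K, hAL]
        simp only [Matrix.mul_smul, Matrix.mul_assoc, smul_smul]
      have e3 := e1.symm.trans e2
      have e4 : Â i x * ((L i j)ᴴ * K * L i' j')
          = (lam i j : ℂ)⁻¹ • ((lam i j : ℂ) • (Â i x * ((L i j)ᴴ * K * L i' j'))) := by
        rw [smul_smul, inv_mul_cancel₀ hne, one_smul]
      rw [e4, e3, smul_smul]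
      congr 1
      push_cast
      field_simp
    have hpos : ∀ i j i' j', 0 < l * lam i' j' / lam i j := fun i j i' j' =>
      div_pos (mul_pos hl (hlam _ _)) (hlam _ _)
    have hsc : ∀ i j j', ∃ c : ℂ, (L i j)ᴴ * K * L i j' = c • (1 : Matrix _ _ ℂ) := fun i j j' =>
      schur_same (Â i) (hÂ i) (hirr i) _ (hpos i j i j') _ (hT i j i j')
    choose G hG using hsc
    refine ⟨fun i => Matrix.of (G i), ?_⟩
    ext s t
    rw [hW, bigW_sandwich]
    obtain ⟨i, α, j⟩ := s
    obtain ⟨i', α', j'⟩ := t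
    dsimp only
    by_cases h : i = i'
    · subst h
      rw [hG, Matrix.blockDiagonal'_apply_eq, Matrix.kroneckerMap_apply]
      simp [mul_comm]
    · rw [hneq i i' h _ (hpos i j i' j') _ (hT i j i' j'), Matrix.blockDiagonal'_apply_ne _ _ _ h]
      rfl
  have hF : ∀ y, ∃ G : ∀ i, Matrix (Fin (b i)) (Fin (b i)) ℂ, ∀ x, Wᴴ * A x y * W =
      (Matrix.blockDiagonal' fun i => (1 : Matrix (Fin (a i)) (Fin (a i)) ℂ) ⊗ₖ G i)
        * (Wᴴ * (∑ y, A x y) * W) := by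
    intro y
    obtain ⟨s, S, hs0, hS1, hS⟩ := hIntw y
    have hS' : ∀ x, ∀ c ∈ s, (S c)ᴴ * A x y = (c : ℂ) • ((∑ y', A x y') * (S c)ᴴ) := by
      intro x c hc
      have := congrArg conjTranspose (hS x c hc)
      rw [conjTranspose_mul, conjTranspose_smul, conjTranspose_mul, (hAs x).1.eq, (hA x y).1.eq]
        at this
      simpa using this
    have hS1' : ∑ c ∈ s, (S c)ᴴ = 1 := by
      rw [← conjTranspose_sum, hS1, conjTranspose_one]
    -- each pair of weights
    have hpair : ∀ c c' : ℝ, ∃ G : ∀ i, Matrix (Fin (b i)) (Fin (b i)) ℂ, c ∈ s → c' ∈ s → ∀ x,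
        Wᴴ * ((S c')ᴴ * A x y * S c) * W =
        (Matrix.blockDiagonal' fun i => (1 : Matrix (Fin (a i)) (Fin (a i)) ℂ) ⊗ₖ G i)
          * (Wᴴ * (∑ y, A x y) * W) := by
      intro c c'
      by_cases hcs : c ∈ s ∧ c' ∈ s
      · obtain ⟨h1, h2⟩ := hcs
        by_cases h0 : c = 0 ∨ c' = 0
        · refine ⟨fun i => 0, fun _ _ x => ?_⟩
          have : (S c')ᴴ * A x y * S c = 0 := by
            rcases h0 with h0 | h0
            · rw [Matrix.mul_assoc, hS x c h1, h0]; simp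
            · rw [hS' x c' h2, h0]; simp
          rw [this]
          have hz : (Matrix.blockDiagonal' fun i => (1 : Matrix (Fin (a i)) (Fin (a i)) ℂ) ⊗ₖ
              (0 : Matrix (Fin (b i)) (Fin (b i)) ℂ)) = 0 := by
            simp only [Matrix.kronecker_zero]
            exact Matrix.blockDiagonal'_zero
          rw [hz]; simp
        · push Not at h0
          have hc : 0 < c := lt_of_le_of_ne (hs0 c h1) (Ne.symm h0.1)
          have hc' : 0 < c' := lt_of_le_of_ne (hs0 c' h2) (Ne.symm h0.2)
          have hcc' : (c' : ℂ) ≠ 0 := by exact_mod_cast h0.2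
          have e : ∀ x, (S c')ᴴ * A x y * S c = (c : ℂ) • ((S c')ᴴ * S c * ∑ y, A x y) := by
            intro x
            rw [Matrix.mul_assoc, hS x c h1, Matrix.mul_smul, Matrix.mul_assoc]
          obtain ⟨G, hG⟩ := hK (c / c') ((S c')ᴴ * S c) (div_pos hc hc') (by
            intro x
            have e2 : (S c')ᴴ * A x y * S c = (c' : ℂ) • ((∑ y, A x y) * ((S c')ᴴ * S c)) := by
              rw [hS' x c' h2, Matrix.smul_mul, Matrix.mul_assoc]
            have e3 := e2.symm.trans (e x)
            have e4 : (∑ y, A x y) * ((S c')ᴴ * S c)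
                = (c' : ℂ)⁻¹ • ((c' : ℂ) • ((∑ y, A x y) * ((S c')ᴴ * S c))) := by
              rw [smul_smul, inv_mul_cancel₀ hcc', one_smul]
            rw [e4, e3, smul_smul]
            congr 1
            push_cast
            field_simp)
          refine ⟨fun i => (c : ℂ) • G i, fun _ _ x => ?_⟩
          have hz : (Matrix.blockDiagonal' fun i => (1 : Matrix (Fin (a i)) (Fin (a i)) ℂ) ⊗ₖ
              ((c : ℂ) • G i)) = (c : ℂ) • (Wᴴ * ((S c')ᴴ * S c) * W) := by
            rw [hG, ← Matrix.blockDiagonal'_smul]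
            congr 1
            funext i
            simp [Matrix.kronecker_smul]
          rw [hz, e x]
          have : Wᴴ * ((S c')ᴴ * S c) * W * (Wᴴ * (∑ y, A x y) * W)
              = Wᴴ * ((S c')ᴴ * S c) * (W * Wᴴ) * (∑ y, A x y) * W := by
            simp only [Matrix.mul_assoc]
          rw [Matrix.smul_mul, this, hWW, Matrix.mul_one, Matrix.mul_smul, Matrix.smul_mul]
          simp only [Matrix.mul_assoc]
      · exact ⟨fun i => 0, fun h1 h2 => absurd ⟨h1, h2⟩ hcs⟩
    choose G hG using hpair
    refine ⟨fun i => ∑ c ∈ s, ∑ c' ∈ s, G c c' i, fun x => ?_⟩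
    have hdec : A x y = ∑ c ∈ s, ∑ c' ∈ s, (S c')ᴴ * A x y * S c := by
      calc A x y = (∑ c' ∈ s, (S c')ᴴ) * A x y * (∑ c ∈ s, S c) := by
            rw [hS1', hS1, Matrix.one_mul, Matrix.mul_one]
        _ = _ := by
            rw [Matrix.mul_sum]
            refine Finset.sum_congr rfl fun c _ => ?_
            rw [Matrix.sum_mul, Matrix.sum_mul]
    have hbd : (Matrix.blockDiagonal' fun i => (1 : Matrix (Fin (a i)) (Fin (a i)) ℂ) ⊗ₖ
        (∑ c ∈ s, ∑ c' ∈ s, G c c' i)) = ∑ c ∈ s, ∑ c' ∈ s,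
        (Matrix.blockDiagonal' fun i => (1 : Matrix (Fin (a i)) (Fin (a i)) ℂ) ⊗ₖ G c c' i) := by
      ext s t
      obtain ⟨i, α, j⟩ := s
      obtain ⟨i', α', j'⟩ := t
      simp only [Matrix.sum_apply]
      by_cases h : i = i'
      · subst h
        simp only [Matrix.blockDiagonal'_apply_eq, Matrix.kroneckerMap_apply, Matrix.sum_apply,
          Finset.mul_sum]
      · simp only [Matrix.blockDiagonal'_apply_ne _ _ _ h, Finset.sum_const_zero]
    conv_lhs => rw [hdec]
    rw [hbd, Matrix.mul_sum, Matrix.sum_mul, Matrix.sum_mul]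
    refine Finset.sum_congr rfl fun c hc => ?_
    rw [Matrix.mul_sum, Matrix.sum_mul, Matrix.sum_mul]
    refine Finset.sum_congr rfl fun c' hc' => ?_
    exact hG c c' hc hc' x
  choose G hG using hF
  refine ⟨N, a, b, Â, fun i y => G y i * diagonal (fun j => (lam i j : ℂ)), W, ha, hb, hÂ, hW1, hWW,
    ?_⟩
  intro x y
  rw [hG, hWA, ← Matrix.blockDiagonal'_mul]
  congr 1
  funext i
  rw [← Matrix.mul_kronecker_mul, Matrix.one_mul]
end Final

section Assemble

lemma psd_pos_diag {m : Type*} [Fintype m] [DecidableEq m] {X : Matrix m m ℂ}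
    (hX : X.PosSemidef) (h0 : X ≠ 0) : ∃ (i : m) (t : ℝ), 0 < t ∧ X i i = (t : ℂ) := by
  have htr : X.trace ≠ 0 := fun h => h0 (hX.trace_eq_zero_iff.mp h)
  obtain ⟨i, hi⟩ : ∃ i, X i i ≠ 0 := by
    by_contra h
    push Not at h
    exact htr (by simp [Matrix.trace, h])
  have h1 : 0 ≤ X i i := hX.diag_nonneg
  have h2 : X i i = ((X i i).re : ℂ) := Complex.eq_re_of_ofReal_le h1
  refine ⟨i, (X i i).re, ?_, h2⟩
  have h3 : 0 ≤ (X i i).re := by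
    rw [h2] at h1
    exact_mod_cast h1
  refine lt_of_le_of_ne h3 ?_
  intro h4
  apply hi
  rw [h2, ← h4]; simp

lemma psd_of_block {N : ℕ} {a b : Fin N → ℕ} (X : ∀ i, Matrix (Fin (a i)) (Fin (a i)) ℂ)
    (H : ∀ i, Matrix (Fin (b i)) (Fin (b i)) ℂ)
    (hP : (Matrix.blockDiagonal' fun i => X i ⊗ₖ H i).PosSemidef)
    (i : Fin N) (hX : (X i).PosSemidef) (h0 : X i ≠ 0) : (H i).PosSemidef := by
  obtain ⟨α, t, ht, hα⟩ := psd_pos_diag hX h0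
  have h1 := hP.submatrix (fun j : Fin (b i) => (⟨i, α, j⟩ : Σ i : Fin N, Fin (a i) × Fin (b i)))
  have htc : (t : ℂ) ≠ 0 := by exact_mod_cast ht.ne'
  have h2 : H i = ((t⁻¹ : ℝ) : ℂ) • ((Matrix.blockDiagonal' fun i => X i ⊗ₖ H i).submatrix
      (fun j : Fin (b i) => (⟨i, α, j⟩ : Σ i : Fin N, Fin (a i) × Fin (b i)))
      (fun j : Fin (b i) => (⟨i, α, j⟩ : Σ i : Fin N, Fin (a i) × Fin (b i)))) := by
    ext j j'
    rw [Matrix.smul_apply, Matrix.submatrix_apply, Matrix.blockDiagonal'_apply_eq,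
      Matrix.kroneckerMap_apply, hα, smul_eq_mul, ← mul_assoc]
    push_cast
    rw [inv_mul_cancel₀ htc, one_mul]
  rw [h2]
  refine h1.smul ?_
  exact_mod_cast (inv_pos.mpr ht).le

lemma exists_state {a : ℕ} (ha : 0 < a) : ∃ σ : Matrix (Fin a) (Fin a) ℂ, IsState σ := by
  refine ⟨((a : ℝ)⁻¹ : ℝ) • (1 : Matrix (Fin a) (Fin a) ℂ), ?_, ?_⟩
  · refine Matrix.PosSemidef.one.smul ?_
    positivity
  · have : (a : ℂ) ≠ 0 := by exact_mod_cast ha.ne'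
    rw [Matrix.trace_smul, Matrix.trace_one, Fintype.card_fin]
    rw [Complex.real_smul]
    push_cast
    exact inv_mul_cancel₀ this

lemma normalize_family {𝒳 : Type*} [Fintype 𝒳] [Nonempty 𝒳] {a : ℕ} (ha : 0 < a)
    (X : 𝒳 → Matrix (Fin a) (Fin a) ℂ) (hX : ∀ x, (X x).PosSemidef) :
    ∃ (w : ℝ) (q : 𝒳 → ℝ) (σ : 𝒳 → Matrix (Fin a) (Fin a) ℂ), 0 ≤ w ∧ (∀ x, 0 ≤ q x) ∧
      ∑ x, q x = 1 ∧ (∀ x, IsState (σ x)) ∧ ∀ x, X x = ((w * q x : ℝ) : ℂ) • σ x := by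
  obtain ⟨σ0, hσ0⟩ := exists_state ha
  have ht : ∀ x, ∃ t : ℝ, 0 ≤ t ∧ (X x).trace = (t : ℂ) := by
    intro x
    have h1 : 0 ≤ (X x).trace := (hX x).trace_nonneg
    have h2 : (X x).trace = ((X x).trace.re : ℂ) := Complex.eq_re_of_ofReal_le h1
    refine ⟨_, ?_, h2⟩
    rw [h2] at h1
    exact_mod_cast h1
  choose t ht0 htr using ht
  have hz : ∀ x, t x = 0 → X x = 0 := by
    intro x h
    refine (hX x).trace_eq_zero_iff.mp ?_
    rw [htr, h]; simp
  have hσ : ∀ x, ∃ σ : Matrix (Fin a) (Fin a) ℂ, IsState σ ∧ X x = ((t x : ℝ) : ℂ) • σ := by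
    intro x
    by_cases h : t x = 0
    · exact ⟨σ0, hσ0, by rw [hz x h, h]; simp⟩
    · have hc : (t x : ℂ) ≠ 0 := by exact_mod_cast h
      refine ⟨(((t x)⁻¹ : ℝ) : ℂ) • X x, ⟨(hX x).smul ?_, ?_⟩, ?_⟩
      · exact_mod_cast inv_nonneg.mpr (ht0 x)
      · rw [Matrix.trace_smul, htr, smul_eq_mul]
        push_cast
        exact inv_mul_cancel₀ hc
      · rw [smul_smul]
        push_cast
        rw [mul_inv_cancel₀ hc, one_smul]
  choose σ hσs hσX using hσ
  by_cases hw : ∑ x, t x = 0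
  · obtain ⟨x0⟩ := ‹Nonempty 𝒳›
    refine ⟨0, Pi.single x0 1, σ, le_rfl, ?_, ?_, hσs, ?_⟩
    · intro x
      by_cases h : x = x0
      · subst h; simp
      · simp [h]
    · simp
    · intro x
      have : t x = 0 := (Finset.sum_eq_zero_iff_of_nonneg (fun x _ => ht0 x)).mp hw x
        (Finset.mem_univ x)
      rw [hz x this]; simp
  · refine ⟨∑ x, t x, fun x => t x / ∑ x, t x, σ, Finset.sum_nonneg fun x _ => ht0 x, ?_, ?_, hσs, ?_⟩
    · intro x
      exact div_nonneg (ht0 x) (Finset.sum_nonneg fun x _ => ht0 x)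
    · rw [← Finset.sum_div, div_self hw]
    · intro x
      rw [mul_div_cancel₀ _ hw]
      exact hσX x

end Assemble


theorem structure_of_vanishing_conditional_mutual_information
    {𝒳 𝒴 : Type*} [Fintype 𝒳] [Fintype 𝒴] {d : ℕ}
    (p : 𝒳 → 𝒴 → ℝ) (ρ : 𝒳 → 𝒴 → Matrix (Fin d) (Fin d) ℂ)
    (hp0 : ∀ x y, 0 ≤ p x y) (hp1 : ∑ x, ∑ y, p x y = 1)
    (hρ : ∀ x y, 0 < p x y → IsState (ρ x y))
    (hcmi : cmiF p ρ = 0) :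
    ∃ (N : ℕ) (_ : 1 ≤ N) (r : Fin N → ℝ) (px : Fin N → 𝒳 → ℝ) (py : Fin N → 𝒴 → ℝ)
      (a b : Fin N → ℕ) (ρX : ∀ i : Fin N, 𝒳 → Matrix (Fin (a i)) (Fin (a i)) ℂ)
      (ρY : ∀ i : Fin N, 𝒴 → Matrix (Fin (b i)) (Fin (b i)) ℂ)
      (U : Matrix (Fin d) (Fin d) ℂ)
      (e : (Σ i : Fin N, Fin (a i) × Fin (b i)) ≃ Fin d),
      (∀ i, 0 ≤ r i) ∧ (∑ i, r i = 1) ∧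
      (∀ i x, 0 ≤ px i x) ∧ (∀ i, ∑ x, px i x = 1) ∧
      (∀ i y, 0 ≤ py i y) ∧ (∀ i, ∑ y, py i y = 1) ∧
      (∀ i, 0 < a i) ∧ (∀ i, 0 < b i) ∧ (∑ i, a i * b i = d) ∧
      (∀ i x, IsState (ρX i x)) ∧ (∀ i y, IsState (ρY i y)) ∧
      U ∈ Matrix.unitaryGroup (Fin d) ℂ ∧
      (∀ x y, ∑ i, r i * px i x * py i y = p x y) ∧
      (∀ x y, 0 < p x y →
        (U * ρ x y * Uᴴ).submatrix e e
          = Matrix.blockDiagonal'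
              fun i => (((r i * px i x * py i y / p x y : ℝ)) : ℂ) • (ρX i x ⊗ₖ ρY i y)) := by
  obtain ⟨hpsd, hIntw⟩ := intertwiners_of_cmi p ρ hp0 hρ hcmi
  obtain ⟨N, a, b, Â, H, W, ha, hb, hÂ, hW1, hWW, hWA⟩ :=
    struct_aux (fun x y => ((p x y : ℝ) : ℂ) • ρ x y) hpsd hIntw
  have hXne : Nonempty 𝒳 := by
    by_contra h
    have : IsEmpty 𝒳 := not_nonempty_iff.mp h
    simp at hp1
  have hYne : Nonempty 𝒴 := by
    by_contra h
    have : IsEmpty 𝒴 := not_nonempty_iff.mp h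
    simp at hp1
  -- positive multiplicity matrices
  have hH : ∀ i, ∃ H' : 𝒴 → Matrix (Fin (b i)) (Fin (b i)) ℂ, (∀ y, (H' y).PosSemidef) ∧
      ∀ x y, Â i x ⊗ₖ H i y = Â i x ⊗ₖ H' y := by
    intro i
    by_cases h : ∃ x, Â i x ≠ 0
    · obtain ⟨x, hx⟩ := h
      refine ⟨H i, fun y => ?_, fun _ _ => rfl⟩
      refine psd_of_block (fun i => Â i x) (fun i => H i y) ?_ i (hÂ i x) hx
      rw [← hWA]
      exact (hpsd x y).conjTranspose_mul_mul_same _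
    · push Not at h
      exact ⟨fun _ => 0, fun _ => Matrix.PosSemidef.zero, fun x y => by rw [h x]; simp⟩
  choose H' hH'p hH' using hH
  have hnX := fun i => normalize_family (ha i) (Â i) (hÂ i)
  have hnY := fun i => normalize_family (hb i) (H' i) (hH'p i)
  choose w q σ hw hq hq1 hσ hσX using hnX
  choose v s τ hv hs hs1 hτ hτY using hnY
  have hblock : ∀ x y, Wᴴ * (((p x y : ℝ) : ℂ) • ρ x y) * W = Matrix.blockDiagonal' fun i =>
      (((w i * v i) * q i x * s i y : ℝ) : ℂ) • (σ i x ⊗ₖ τ i y) := by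
    intro x y
    rw [hWA]
    congr 1
    funext i
    rw [hH', hσX, hτY, Matrix.smul_kronecker, Matrix.kronecker_smul, smul_smul]
    congr 1
    push_cast
    ring
  have hsum : ∀ x y, ∑ i, (w i * v i) * q i x * s i y = p x y := by
    intro x y
    have h1 := congrArg Matrix.trace (hblock x y)
    rw [Matrix.trace_mul_comm, ← Matrix.mul_assoc, hWW, Matrix.one_mul,
      Matrix.trace_blockDiagonal'] at h1
    have h2 : (((p x y : ℝ) : ℂ) • ρ x y).trace = (p x y : ℂ) := by
      rcases (hp0 x y).eq_or_lt with h0 | h0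
      · rw [← h0]; simp
      · rw [Matrix.trace_smul, (hρ x y h0).2]; simp
    rw [h2] at h1
    have h3 : ∀ i, ((((w i * v i) * q i x * s i y : ℝ) : ℂ) • (σ i x ⊗ₖ τ i y)).trace
        = (((w i * v i) * q i x * s i y : ℝ) : ℂ) := by
      intro i
      rw [Matrix.trace_smul, Matrix.trace_kronecker, (hσ i x).2, (hτ i y).2]
      simp
    simp only [h3] at h1
    exact_mod_cast h1.symm
  have hr1 : ∑ i, w i * v i = 1 := by
    rw [← hp1]
    have h1 : ∀ x, ∑ y, p x y = ∑ i, w i * v i * q i x := by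
      intro x
      simp only [← hsum x]
      rw [Finset.sum_comm]
      refine Finset.sum_congr rfl fun i _ => ?_
      rw [← Finset.mul_sum, hs1, mul_one]
    simp only [h1]
    rw [Finset.sum_comm]
    refine Finset.sum_congr rfl fun i _ => ?_
    rw [← Finset.mul_sum, hq1, mul_one]
  have hN : 1 ≤ N := by
    rcases Nat.eq_zero_or_pos N with h | h
    · subst h
      simp at hr1
    · exact h
  have hcard : Fintype.card (Σ i : Fin N, Fin (a i) × Fin (b i)) = d := by
    have h1 : (Wᴴ * W).trace = (W * Wᴴ).trace := Matrix.trace_mul_comm _ _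
    rw [hW1, hWW, Matrix.trace_one, Matrix.trace_one, Fintype.card_fin] at h1
    exact_mod_cast h1
  let e : (Σ i : Fin N, Fin (a i) × Fin (b i)) ≃ Fin d := Fintype.equivFinOfCardEq hcard
  refine ⟨N, hN, fun i => w i * v i, q, s, a, b, σ, τ, Wᴴ.submatrix e.symm id, e,
    fun i => mul_nonneg (hw i) (hv i), hr1, hq, hq1, hs, hs1, ha, hb, ?_, hσ, hτ, ?_, hsum, ?_⟩
  · rw [← hcard]
    simp
  · rw [Matrix.mem_unitaryGroup_iff, Matrix.star_eq_conjTranspose, conjTranspose_submatrix,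
      ← Matrix.submatrix_mul _ _ e.symm id e.symm Function.bijective_id,
      conjTranspose_conjTranspose, hW1]
    exact Matrix.submatrix_one_equiv _
  · intro x y hxy
    have hpc : ((p x y : ℝ) : ℂ) ≠ 0 := by exact_mod_cast hxy.ne'
    have h1 : (Wᴴ.submatrix e.symm id * ρ x y * (Wᴴ.submatrix e.symm id)ᴴ).submatrix e e
        = Wᴴ * ρ x y * W := by
      ext s t
      simp [Matrix.mul_apply]
    have h2 : Wᴴ * ρ x y * W
        = ((p x y : ℝ) : ℂ)⁻¹ • (Wᴴ * (((p x y : ℝ) : ℂ) • ρ x y) * W) := by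
      rw [Matrix.mul_smul, Matrix.smul_mul, smul_smul, inv_mul_cancel₀ hpc, one_smul]
    rw [h1, h2, hblock, ← Matrix.blockDiagonal'_smul]
    congr 1
    funext i
    rw [Pi.smul_apply, smul_smul]
    congr 1
    push_cast
    field_simp

end
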